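/- arXiv:2006.02511 — 12 statements merged into one kernel-verified Lean document; each statement's English description precedes it below -/
import Mathlib

section
/- Let X ∈ End(V) act tridiagonally on the eigenspaces of A. Then [A,[A,[A,X]_q]_{q^{-1}}] = (q^2 − q^{-2})^2 [X, A]; equivalently, A commutes with X + [A,[A,X]_q]_{q^{-1}} / (q^2 − q^{-2})^2. -/
/-- Consecutive terms of the sequence `a q^(d-2i) + a⁻¹ q^(2i-d)` satisfy a fixed symmetric
quadratic relation. -/
theorem consecutive_eigenvalue_relation {F : Type*} [Field F] {q u : F} (hq : q ≠ 0)
    (hu : u ≠ 0) {x y : F} (hx : x = u + u⁻¹) (hy : y = u * (q ^ 2)⁻¹ + u⁻¹ * q ^ 2) :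
    x ^ 2 - (q ^ 2 + (q ^ 2)⁻¹) * x * y + y ^ 2 = -(q ^ 2 - (q ^ 2)⁻¹) ^ 2 := by
  subst hx hy
  field_simp
  ring

/-- Two endomorphisms agree when all their blocks with respect to a resolution of the identity
agree. -/
theorem eq_of_blocks_eq {R ι : Type*} [Ring R] {s : Finset ι} {E : ι → R}
    (hE : ∑ i ∈ s, E i = 1) {Y Z : R}
    (h : ∀ i ∈ s, ∀ j ∈ s, E i * Y * E j = E i * Z * E j) : Y = Z := by
  have key (W : R) : W = ∑ i ∈ s, ∑ j ∈ s, E i * W * E j := by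
    simp_rw [← Finset.mul_sum, hE, mul_one, ← Finset.sum_mul, hE, one_mul]
  rw [key Y, key Z]
  exact Finset.sum_congr rfl fun i hi => Finset.sum_congr rfl fun j hj => h i hi j hj


theorem stmt0
    {F : Type*} [Field F] {V : Type*} [AddCommGroup V] [Module F V]
    [FiniteDimensional F V] [Nontrivial V]
    (q a : F) (hq0 : q ≠ 0) (ha0 : a ≠ 0) (hq4 : q ^ 4 ≠ 1)
    (d : ℕ) (hd : 1 ≤ d)
    (hq2i : ∀ i : ℕ, 1 ≤ i → i ≤ d → q ^ (2 * i) ≠ 1)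
    (ha2 : ∀ j : ℤ, 1 - (d : ℤ) ≤ j → j ≤ (d : ℤ) - 1 → a ^ 2 ≠ q ^ (2 * j))
    (θ : ℕ → F)
    (hθ : ∀ i : ℕ, i ≤ d → θ i = a * q ^ ((d : ℤ) - 2 * (i : ℤ)) + a⁻¹ * q ^ (2 * (i : ℤ) - (d : ℤ)))
    (hθdist : ∀ i j : ℕ, i ≤ d → j ≤ d → i ≠ j → θ i ≠ θ j)
    (A : Module.End F V) (E : ℕ → Module.End F V)
    (hEE : ∀ i j : ℕ, i ≤ d → j ≤ d → E i * E j = if i = j then E i else 0)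
    (hEsum : ∑ i ∈ Finset.range (d + 1), E i = 1)
    (hAE : A = ∑ i ∈ Finset.range (d + 1), θ i • E i)
    (hEne : ∀ i : ℕ, i ≤ d → E i ≠ 0)
    (X : Module.End F V)
    (hX : (∀ i j : ℕ, i ≤ d → j ≤ d → (i + 1 < j ∨ j + 1 < i) → E i * X * E j = 0)) :
    ∀ T1 T2 : Module.End F V,
      T1 = q • (A * X) - q⁻¹ • (X * A) →
      T2 = q⁻¹ • (A * T1) - q • (T1 * A) →
      (A * T2 - T2 * A = ((q ^ 2 - (q ^ 2)⁻¹) ^ 2) • (X * A - A * X) ∧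
        A * (X + ((q ^ 2 - (q ^ 2)⁻¹) ^ 2)⁻¹ • T2)
          = (X + ((q ^ 2 - (q ^ 2)⁻¹) ^ 2)⁻¹ • T2) * A) := by
  intro T1 T2 hT1 hT2
  have hEA (i : ℕ) (hi : i ≤ d) : E i * A = θ i • E i := by
    rw [hAE, Finset.mul_sum, Finset.sum_eq_single i]
    · rw [mul_smul_comm, hEE i i hi hi, if_pos rfl]
    · intro j hj hji
      rw [mul_smul_comm, hEE i j hi (by simpa [Nat.lt_succ_iff] using hj), if_neg hji.symm,
        smul_zero]
    · intro h
      exact absurd (Finset.mem_range.2 (Nat.lt_succ_of_le hi)) h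
  have hAE' (j : ℕ) (hj : j ≤ d) : A * E j = θ j • E j := by
    rw [hAE, Finset.sum_mul, Finset.sum_eq_single j]
    · rw [smul_mul_assoc, hEE j j hj hj, if_pos rfl]
    · intro i hi hij
      rw [smul_mul_assoc, hEE i j (by simpa [Nat.lt_succ_iff] using hi) hj, if_neg hij,
        smul_zero]
    · intro h
      exact absurd (Finset.mem_range.2 (Nat.lt_succ_of_le hj)) h
  have hleft (i j : ℕ) (hi : i ≤ d) (Y : Module.End F V) :
      E i * (A * Y) * E j = θ i • (E i * Y * E j) := by
    rw [← mul_assoc, hEA i hi, smul_mul_assoc, smul_mul_assoc]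
  have hright (i j : ℕ) (hj : j ≤ d) (Y : Module.End F V) :
      E i * (Y * A) * E j = θ j • (E i * Y * E j) := by
    rw [← mul_assoc, mul_assoc, hAE' j hj, mul_smul_comm]
  have hrel (i : ℕ) (hi : i + 1 ≤ d) :
      θ i ^ 2 - (q ^ 2 + (q ^ 2)⁻¹) * θ i * θ (i + 1) + θ (i + 1) ^ 2
        = -(q ^ 2 - (q ^ 2)⁻¹) ^ 2 := by
    refine consecutive_eigenvalue_relation hq0
      (mul_ne_zero ha0 (zpow_ne_zero ((d : ℤ) - 2 * (i : ℤ)) hq0)) ?_ ?_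
    · rw [hθ i (by lia), mul_inv, ← zpow_neg, neg_sub]
    · have h1 : (d : ℤ) - 2 * ((i + 1 : ℕ) : ℤ) = ((d : ℤ) - 2 * (i : ℤ)) + (-(2 : ℕ) : ℤ) := by
        push_cast; ring
      have h2 : 2 * ((i + 1 : ℕ) : ℤ) - (d : ℤ) = -((d : ℤ) - 2 * (i : ℤ)) + ((2 : ℕ) : ℤ) := by
        push_cast; ring
      rw [hθ (i + 1) hi, h1, h2, zpow_add₀ hq0, zpow_add₀ hq0, zpow_neg, zpow_neg, zpow_natCast,
        mul_inv]
      ring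
  have hmain : A * T2 - T2 * A = ((q ^ 2 - (q ^ 2)⁻¹) ^ 2) • (X * A - A * X) := by
    refine eq_of_blocks_eq hEsum fun i hi j hj => ?_
    replace hi : i ≤ d := Nat.lt_succ_iff.1 (Finset.mem_range.1 hi)
    replace hj : j ≤ d := Nat.lt_succ_iff.1 (Finset.mem_range.1 hj)
    have hT2b : E i * T2 * E j
        = (θ i ^ 2 - (q ^ 2 + (q ^ 2)⁻¹) * θ i * θ j + θ j ^ 2) • (E i * X * E j) := by
      rw [hT2, hT1]
      simp only [mul_sub, sub_mul, mul_smul_comm, smul_mul_assoc, hleft i j hi, hright i j hj,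
        smul_smul, ← sub_smul]
      congr 1
      field_simp
      ring
    rw [mul_sub, sub_mul, hleft i j hi, hright i j hj, hT2b, mul_smul_comm, smul_mul_assoc,
      mul_sub, sub_mul, hleft i j hi, hright i j hj, smul_smul, smul_smul, ← sub_smul,
      ← sub_smul, smul_smul]
    by_cases hfar : i + 1 < j ∨ j + 1 < i
    · rw [hX i j hi hj hfar, smul_zero, smul_zero]
    congr 1
    obtain rfl | rfl | rfl : i = j ∨ j = i + 1 ∨ i = j + 1 := by lia
    · ring
    · linear_combination (θ i - θ (i + 1)) * hrel i hj
    · linear_combination (θ (j + 1) - θ j) * hrel j hi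
  refine ⟨hmain, ?_⟩
  have hc : (q ^ 2 - (q ^ 2)⁻¹) ^ 2 ≠ 0 := by
    refine pow_ne_zero 2 fun h => hq4 ?_
    field_simp at h
    linear_combination h
  rw [mul_add, add_mul, mul_smul_comm, smul_mul_assoc, ← sub_eq_zero]
  have h := congrArg (fun Y => ((q ^ 2 - (q ^ 2)⁻¹) ^ 2)⁻¹ • Y) hmain
  simp only [inv_smul_smul₀ hc, smul_sub] at h
  rw [add_sub_add_comm, h]
  abel
end

section
/- For X, Y ∈ End(V) the following are equivalent: (i) X acts tridiagonally on the eigenspaces of A, and A commutes with Y + (qXA − q^{-1}AX)/(q^2 − q^{-2}); (ii) Y acts tridiagonally on the eigenspaces of A, and A commutes with X + (qAY − q^{-1}YA)/(q^2 − q^{-2}). -/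
section Peirce

variable {F R : Type*} [Field F] [Ring R] [Algebra F R]

/-- Elements with the same Peirce components for a complete system `E` are equal. -/
theorem eq_of_forall_corner_eq {n : ℕ} {E : ℕ → R} (hsum : ∑ i ∈ Finset.range n, E i = 1)
    {S T : R} (h : ∀ i < n, ∀ j < n, E i * S * E j = E i * T * E j) : S = T := by
  have expand (W : R) :
      W = ∑ i ∈ Finset.range n, ∑ j ∈ Finset.range n, E i * W * E j := by
    simp_rw [← Finset.mul_sum, hsum, mul_one, ← Finset.sum_mul, hsum, one_mul]
  rw [expand S, expand T]
  exact Finset.sum_congr rfl fun i hi => Finset.sum_congr rfl fun j hj =>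
    h i (Finset.mem_range.1 hi) j (Finset.mem_range.1 hj)

/-- An element commutes with `A` iff its off-diagonal Peirce components vanish, when the `E i` are
the spectral idempotents of `A` for distinct eigenvalues. -/
theorem commute_iff_forall_corner_eq_zero {n : ℕ} {E : ℕ → R} {θ : ℕ → F} {A : R}
    (hsum : ∑ i ∈ Finset.range n, E i = 1)
    (hdist : ∀ i < n, ∀ j < n, i ≠ j → θ i ≠ θ j)
    (hl : ∀ i < n, E i * A = θ i • E i) (hr : ∀ i < n, A * E i = θ i • E i) (Z : R) :
    A * Z = Z * A ↔ ∀ i < n, ∀ j < n, i ≠ j → E i * Z * E j = 0 := by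
  have left (i j : ℕ) (hi : i < n) : E i * (A * Z) * E j = θ i • (E i * Z * E j) := by
    rw [← mul_assoc, hl i hi, smul_mul_assoc, smul_mul_assoc]
  have right (i j : ℕ) (hj : j < n) : E i * (Z * A) * E j = θ j • (E i * Z * E j) := by
    rw [← mul_assoc, mul_assoc _ A, hr j hj, mul_smul_comm]
  constructor
  · intro h i hi j hj hij
    have key := left i j hi
    rw [h, right i j hj, ← sub_eq_zero, ← sub_smul] at key
    exact (smul_eq_zero_iff_right (sub_ne_zero.2 (hdist j hj i hi hij.symm))).1 key
  · intro h
    refine eq_of_forall_corner_eq hsum fun i hi j hj => ?_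
    rw [left i j hi, right i j hj]
    by_cases hij : i = j
    · rw [hij]
    · rw [h i hi j hj hij, smul_zero, smul_zero]

end Peirce

/-- For consecutive terms `t + t⁻¹` and `t q⁻² + t⁻¹ q²` of a `q`-Racah sequence, the two
normalized `q`-differences are inverse to each other. -/
theorem qdiff_mul_qdiff_eq_one {F : Type*} [Field F] {q t x y : F} (hq : q ≠ 0) (ht : t ≠ 0)
    (hq4 : q ^ 4 ≠ 1) (hx : x = t + t⁻¹) (hy : y = t * (q ^ 2)⁻¹ + t⁻¹ * q ^ 2) :
    ((q ^ 2 - (q ^ 2)⁻¹)⁻¹ * (q * y - q⁻¹ * x)) *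
      ((q ^ 2 - (q ^ 2)⁻¹)⁻¹ * (q * x - q⁻¹ * y)) = 1 := by
  have hc : q ^ 2 - (q ^ 2)⁻¹ ≠ 0 := by
    intro h
    apply hq4
    field_simp at h
    linear_combination h
  have h₁ : q * y - q⁻¹ * x = (q ^ 2 - (q ^ 2)⁻¹) * (q * t⁻¹) := by
    subst hx hy
    field_simp
    ring
  have h₂ : q * x - q⁻¹ * y = (q ^ 2 - (q ^ 2)⁻¹) * (q⁻¹ * t) := by
    subst hx hy
    field_simp
    ring
  rw [h₁, h₂, inv_mul_cancel_left₀ hc, inv_mul_cancel_left₀ hc]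
  field_simp


theorem stmt1
    {F : Type*} [Field F] {V : Type*} [AddCommGroup V] [Module F V]
    [FiniteDimensional F V] [Nontrivial V]
    (q a : F) (hq0 : q ≠ 0) (ha0 : a ≠ 0) (hq4 : q ^ 4 ≠ 1)
    (d : ℕ) (hd : 1 ≤ d)
    (hq2i : ∀ i : ℕ, 1 ≤ i → i ≤ d → q ^ (2 * i) ≠ 1)
    (ha2 : ∀ j : ℤ, 1 - (d : ℤ) ≤ j → j ≤ (d : ℤ) - 1 → a ^ 2 ≠ q ^ (2 * j))
    (θ : ℕ → F)
    (hθ : ∀ i : ℕ, i ≤ d → θ i = a * q ^ ((d : ℤ) - 2 * (i : ℤ)) + a⁻¹ * q ^ (2 * (i : ℤ) - (d : ℤ)))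
    (hθdist : ∀ i j : ℕ, i ≤ d → j ≤ d → i ≠ j → θ i ≠ θ j)
    (A : Module.End F V) (E : ℕ → Module.End F V)
    (hEE : ∀ i j : ℕ, i ≤ d → j ≤ d → E i * E j = if i = j then E i else 0)
    (hEsum : ∑ i ∈ Finset.range (d + 1), E i = 1)
    (hAE : A = ∑ i ∈ Finset.range (d + 1), θ i • E i)
    (hEne : ∀ i : ℕ, i ≤ d → E i ≠ 0)
    (X Y : Module.End F V) :
    ((∀ i j : ℕ, i ≤ d → j ≤ d → (i + 1 < j ∨ j + 1 < i) → E i * X * E j = 0) ∧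
      A * (Y + (q ^ 2 - (q ^ 2)⁻¹)⁻¹ • (q • (X * A) - q⁻¹ • (A * X)))
        = (Y + (q ^ 2 - (q ^ 2)⁻¹)⁻¹ • (q • (X * A) - q⁻¹ • (A * X))) * A)
    ↔
    ((∀ i j : ℕ, i ≤ d → j ≤ d → (i + 1 < j ∨ j + 1 < i) → E i * Y * E j = 0) ∧
      A * (X + (q ^ 2 - (q ^ 2)⁻¹)⁻¹ • (q • (A * Y) - q⁻¹ • (Y * A)))
        = (X + (q ^ 2 - (q ^ 2)⁻¹)⁻¹ • (q • (A * Y) - q⁻¹ • (Y * A))) * A) := by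
  have hl : ∀ i < d + 1, E i * A = θ i • E i := by
    intro i hi
    rw [hAE, Finset.mul_sum, Finset.sum_eq_single_of_mem i (Finset.mem_range.2 hi)]
    · rw [mul_smul_comm, hEE i i (by omega) (by omega), if_pos rfl]
    · intro j hj hji
      rw [mul_smul_comm, hEE i j (by omega) (by have := Finset.mem_range.1 hj; omega),
        if_neg hji.symm, smul_zero]
  have hr : ∀ i < d + 1, A * E i = θ i • E i := by
    intro i hi
    rw [hAE, Finset.sum_mul, Finset.sum_eq_single_of_mem i (Finset.mem_range.2 hi)]
    · rw [smul_mul_assoc, hEE i i (by omega) (by omega), if_pos rfl]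
    · intro j hj hji
      rw [smul_mul_assoc, hEE j i (by have := Finset.mem_range.1 hj; omega) (by omega),
        if_neg hji, smul_zero]
  have hcomm := commute_iff_forall_corner_eq_zero hEsum
    (fun i hi j hj => hθdist i j (by omega) (by omega)) hl hr
  rw [hcomm, hcomm]
  set c := (q ^ 2 - (q ^ 2)⁻¹)⁻¹
  have hXA (W : Module.End F V) (i j : ℕ) (hj : j < d + 1) :
      E i * (W * A) * E j = θ j • (E i * W * E j) := by
    rw [← mul_assoc, mul_assoc _ A, hr j hj, mul_smul_comm]
  have hAX (W : Module.End F V) (i j : ℕ) (hi : i < d + 1) :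
      E i * (A * W) * E j = θ i • (E i * W * E j) := by
    rw [← mul_assoc, hl i hi, smul_mul_assoc, smul_mul_assoc]
  have hcornerY (i j : ℕ) (hi : i < d + 1) (hj : j < d + 1) :
      E i * (Y + c • (q • (X * A) - q⁻¹ • (A * X))) * E j =
        E i * Y * E j + (c * (q * θ j - q⁻¹ * θ i)) • (E i * X * E j) := by
    simp only [mul_add, add_mul, mul_sub, sub_mul, mul_smul_comm, smul_mul_assoc,
      hXA X i j hj, hAX X i j hi]
    module
  have hcornerX (i j : ℕ) (hi : i < d + 1) (hj : j < d + 1) :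
      E i * (X + c • (q • (A * Y) - q⁻¹ • (Y * A))) * E j =
        E i * X * E j + (c * (q * θ i - q⁻¹ * θ j)) • (E i * Y * E j) := by
    simp only [mul_add, add_mul, mul_sub, sub_mul, mul_smul_comm, smul_mul_assoc,
      hXA Y i j hj, hAX Y i j hi]
    module
  have hsucc (i : ℕ) (hi : i + 1 < d + 1) :
      (c * (q * θ (i + 1) - q⁻¹ * θ i)) * (c * (q * θ i - q⁻¹ * θ (i + 1))) = 1 := by
    refine qdiff_mul_qdiff_eq_one (t := a * q ^ ((d : ℤ) - 2 * (i : ℤ))) hq0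
      (mul_ne_zero ha0 (zpow_ne_zero _ hq0)) hq4 ?_ ?_
    · rw [hθ i (by omega), mul_inv, ← zpow_neg, neg_sub]
    · have h₁ : (d : ℤ) - 2 * ((i + 1 : ℕ) : ℤ) = ((d : ℤ) - 2 * (i : ℤ)) - (2 : ℕ) := by
        push_cast; ring
      have h₂ : 2 * ((i + 1 : ℕ) : ℤ) - (d : ℤ) = -((d : ℤ) - 2 * (i : ℤ)) + (2 : ℕ) := by
        push_cast; ring
      rw [hθ (i + 1) (by omega), h₁, h₂, zpow_sub₀ hq0, zpow_add₀ hq0, zpow_neg, zpow_natCast,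
        mul_inv, div_eq_mul_inv, mul_assoc, mul_assoc]
  have hadj (i j : ℕ) (hi : i < d + 1) (hj : j < d + 1) (h : i + 1 = j ∨ j + 1 = i) :
      (c * (q * θ j - q⁻¹ * θ i)) * (c * (q * θ i - q⁻¹ * θ j)) = 1 := by
    rcases h with rfl | rfl
    · exact hsucc i hj
    · rw [mul_comm]
      exact hsucc j hi
  constructor
  · rintro ⟨hX, hY⟩
    have hY' (i j : ℕ) (hi : i < d + 1) (hj : j < d + 1) (hij : i ≠ j) :
        E i * Y * E j = -((c * (q * θ j - q⁻¹ * θ i)) • (E i * X * E j)) :=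
      eq_neg_of_add_eq_zero_left ((hcornerY i j hi hj).symm.trans (hY i hi j hj hij))
    refine ⟨fun i j hi hj h => ?_, fun i hi j hj hij => ?_⟩
    · rw [hY' i j (by omega) (by omega) (by omega), hX i j hi hj h, smul_zero, neg_zero]
    · rw [hcornerX i j hi hj, hY' i j hi hj hij]
      by_cases h : i + 1 = j ∨ j + 1 = i
      · rw [smul_neg, smul_smul, mul_comm, hadj i j hi hj h, one_smul, add_neg_cancel]
      · rw [hX i j (by omega) (by omega) (by omega), smul_zero, neg_zero, smul_zero, add_zero]
  · rintro ⟨hY, hX⟩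
    have hX' (i j : ℕ) (hi : i < d + 1) (hj : j < d + 1) (hij : i ≠ j) :
        E i * X * E j = -((c * (q * θ i - q⁻¹ * θ j)) • (E i * Y * E j)) :=
      eq_neg_of_add_eq_zero_left ((hcornerX i j hi hj).symm.trans (hX i hi j hj hij))
    refine ⟨fun i j hi hj h => ?_, fun i hi j hj hij => ?_⟩
    · rw [hX' i j (by omega) (by omega) (by omega), hY i j hi hj h, smul_zero, neg_zero]
    · rw [hcornerY i j hi hj, hX' i j hi hj hij]
      by_cases h : i + 1 = j ∨ j + 1 = i
      · rw [smul_neg, smul_smul, hadj i j hi hj h, one_smul, add_neg_cancel]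
      · rw [hY i j (by omega) (by omega) (by omega), smul_zero, neg_zero, smul_zero, add_zero]
end

section
/- Let X ∈ End(V) act tridiagonally on the eigenspaces of A. Then X + [A,[A,X]_q]_{q^{-1}} / (q^2 − q^{-2})^2 = (I − A^2/(q + q^{-1})^2) X^∨. -/
theorem eq_of_sandwich_eq {R : Type*} [Ring R] {n : ℕ} {E : ℕ → R}
    (hsum : ∑ i ∈ Finset.range n, E i = 1) {Y Z : R}
    (h : ∀ i < n, ∀ j < n, E i * Y * E j = E i * Z * E j) : Y = Z := by
  have expand : ∀ W : R,
      W = ∑ i ∈ Finset.range n, ∑ j ∈ Finset.range n, E i * W * E j := by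
    intro W
    simp_rw [← Finset.mul_sum, hsum, mul_one, ← Finset.sum_mul, hsum, one_mul]
  rw [expand Y, expand Z]
  refine Finset.sum_congr rfl fun i hi => Finset.sum_congr rfl fun j hj => ?_
  exact h i (Finset.mem_range.1 hi) j (Finset.mem_range.1 hj)

theorem sq_ne_inv_sq {F : Type*} [Field F] {q : F} (hq0 : q ≠ 0) (hq4 : q ^ 4 ≠ 1) :
    q ^ 2 - (q ^ 2)⁻¹ ≠ 0 := by
  intro h
  apply hq4
  field_simp at h
  linear_combination h

theorem add_inv_ne_zero_of_pow_four_ne_one {F : Type*} [Field F] {q : F}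
    (hq0 : q ≠ 0) (hq4 : q ^ 4 ≠ 1) : q + q⁻¹ ≠ 0 := by
  intro h
  apply hq4
  field_simp at h
  linear_combination (q ^ 2 - 1) * h

theorem one_add_quadratic_of_adjacent {F : Type*} [Field F] {q u v s t : F}
    (hq0 : q ≠ 0) (hq4 : q ^ 4 ≠ 1) (huv : u * v = 1)
    (hs : s = u + v) (ht : t = u * (q ^ 2)⁻¹ + v * q ^ 2) :
    1 + ((q ^ 2 - (q ^ 2)⁻¹) ^ 2)⁻¹ * (s ^ 2 - (q ^ 2 + (q ^ 2)⁻¹) * (s * t) + t ^ 2) = 0 := by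
  have hne := sq_ne_inv_sq hq0 hq4
  have key : s ^ 2 - (q ^ 2 + (q ^ 2)⁻¹) * (s * t) + t ^ 2 = -(q ^ 2 - (q ^ 2)⁻¹) ^ 2 := by
    have hp : q ^ 2 * (q ^ 2)⁻¹ = 1 := mul_inv_cancel₀ (pow_ne_zero 2 hq0)
    generalize (q ^ 2)⁻¹ = p at *
    generalize q ^ 2 = r at *
    subst hs ht
    have hv : v = u⁻¹ := eq_inv_of_mul_eq_one_right huv
    have hu : u ≠ 0 := left_ne_zero_of_mul_eq_one huv
    have hpr : p = r⁻¹ := eq_inv_of_mul_eq_one_right hp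
    have hr : r ≠ 0 := left_ne_zero_of_mul_eq_one hp
    subst hv hpr
    field_simp
    ring
  rw [key, mul_neg, inv_mul_cancel₀ (pow_ne_zero 2 hne), add_neg_cancel]

theorem one_add_quadratic_self {F : Type*} [Field F] {q : F}
    (hq0 : q ≠ 0) (hq4 : q ^ 4 ≠ 1) (s : F) :
    1 + ((q ^ 2 - (q ^ 2)⁻¹) ^ 2)⁻¹ * (s ^ 2 - (q ^ 2 + (q ^ 2)⁻¹) * (s * s) + s ^ 2)
      = 1 - ((q + q⁻¹) ^ 2)⁻¹ * s ^ 2 := by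
  have hne := sq_ne_inv_sq hq0 hq4
  have hne' := add_inv_ne_zero_of_pow_four_ne_one hq0 hq4
  have hfac : q ^ 2 - (q ^ 2)⁻¹ = (q - q⁻¹) * (q + q⁻¹) := by
    field_simp
    ring
  have hm : q - q⁻¹ ≠ 0 := by
    rintro h
    rw [hfac, h, zero_mul] at hne
    exact hne rfl
  have key : s ^ 2 - (q ^ 2 + (q ^ 2)⁻¹) * (s * s) + s ^ 2 = -((q - q⁻¹) ^ 2 * s ^ 2) := by
    field_simp
    ring
  rw [key, hfac]
  generalize q - q⁻¹ = m at *
  generalize q + q⁻¹ = p at *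
  field_simp
  ring


theorem stmt2
    {F : Type*} [Field F] {V : Type*} [AddCommGroup V] [Module F V]
    [FiniteDimensional F V] [Nontrivial V]
    (q a : F) (hq0 : q ≠ 0) (ha0 : a ≠ 0) (hq4 : q ^ 4 ≠ 1)
    (d : ℕ) (hd : 1 ≤ d)
    (hq2i : ∀ i : ℕ, 1 ≤ i → i ≤ d → q ^ (2 * i) ≠ 1)
    (ha2 : ∀ j : ℤ, 1 - (d : ℤ) ≤ j → j ≤ (d : ℤ) - 1 → a ^ 2 ≠ q ^ (2 * j))
    (θ : ℕ → F)
    (hθ : ∀ i : ℕ, i ≤ d → θ i = a * q ^ ((d : ℤ) - 2 * (i : ℤ)) + a⁻¹ * q ^ (2 * (i : ℤ) - (d : ℤ)))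
    (hθdist : ∀ i j : ℕ, i ≤ d → j ≤ d → i ≠ j → θ i ≠ θ j)
    (A : Module.End F V) (E : ℕ → Module.End F V)
    (hEE : ∀ i j : ℕ, i ≤ d → j ≤ d → E i * E j = if i = j then E i else 0)
    (hEsum : ∑ i ∈ Finset.range (d + 1), E i = 1)
    (hAE : A = ∑ i ∈ Finset.range (d + 1), θ i • E i)
    (hEne : ∀ i : ℕ, i ≤ d → E i ≠ 0)
    (X : Module.End F V)
    (hX : (∀ i j : ℕ, i ≤ d → j ≤ d → (i + 1 < j ∨ j + 1 < i) → E i * X * E j = 0)) :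
    ∀ T1 T2 : Module.End F V,
      T1 = q • (A * X) - q⁻¹ • (X * A) →
      T2 = q⁻¹ • (A * T1) - q • (T1 * A) →
      X + ((q ^ 2 - (q ^ 2)⁻¹) ^ 2)⁻¹ • T2
        = (1 - ((q + q⁻¹) ^ 2)⁻¹ • (A * A)) * (∑ i ∈ Finset.range (d + 1), E i * X * E i) := by
  rintro T1 T2 rfl rfl
  have hAl : ∀ i ≤ d, E i * A = θ i • E i := by
    intro i hi
    rw [hAE, Finset.mul_sum, Finset.sum_eq_single i]
    · rw [mul_smul_comm, hEE i i hi hi, if_pos rfl]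
    · intro j hj hji
      rw [mul_smul_comm, hEE i j hi (by simpa [Nat.lt_succ_iff] using hj), if_neg hji.symm,
        smul_zero]
    · intro h
      exact absurd (Finset.mem_range.2 (Nat.lt_succ_of_le hi)) h
  have hAr : ∀ i ≤ d, A * E i = θ i • E i := by
    intro i hi
    rw [hAE, Finset.sum_mul, Finset.sum_eq_single i]
    · rw [smul_mul_assoc, hEE i i hi hi, if_pos rfl]
    · intro j hj hji
      rw [smul_mul_assoc, hEE j i (by simpa [Nat.lt_succ_iff] using hj) hi, if_neg hji,
        smul_zero]
    · intro h
      exact absurd (Finset.mem_range.2 (Nat.lt_succ_of_le hi)) h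
  have hdiag : ∀ i ≤ d, ∀ j ≤ d,
      E i * (∑ k ∈ Finset.range (d + 1), E k * X * E k) * E j
        = if i = j then E i * X * E j else 0 := by
    intro i hi j hj
    rw [Finset.mul_sum, Finset.sum_mul, Finset.sum_eq_single i]
    · rw [← mul_assoc, ← mul_assoc, hEE i i hi hi, if_pos rfl, mul_assoc, hEE i j hi hj]
      split_ifs with h
      · rw [h]
      · rw [mul_zero]
    · intro k hk hki
      rw [← mul_assoc, ← mul_assoc, hEE i k hi (by simpa [Nat.lt_succ_iff] using hk),
        if_neg hki.symm]
      simp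
    · intro h
      exact absurd (Finset.mem_range.2 (Nat.lt_succ_of_le hi)) h
  have hstep : ∀ i, i + 1 ≤ d → ∃ u v : F, u * v = 1 ∧ θ i = u + v ∧
      θ (i + 1) = u * (q ^ 2)⁻¹ + v * q ^ 2 := by
    intro i hi
    refine ⟨a * q ^ ((d : ℤ) - 2 * (i : ℤ)), a⁻¹ * q ^ (2 * (i : ℤ) - (d : ℤ)), ?_,
      hθ i (by omega), ?_⟩
    · rw [mul_mul_mul_comm, mul_inv_cancel₀ ha0, ← zpow_add₀ hq0, one_mul]
      simp
    · rw [hθ (i + 1) hi, mul_assoc, mul_assoc, ← zpow_natCast q 2, ← zpow_neg,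
        ← zpow_add₀ hq0, ← zpow_add₀ hq0]
      congr 3 <;> push_cast <;> ring
  refine eq_of_sandwich_eq hEsum fun i hi j hj => ?_
  replace hi : i ≤ d := Nat.lt_succ_iff.1 hi
  replace hj : j ≤ d := Nat.lt_succ_iff.1 hj
  set D := ∑ k ∈ Finset.range (d + 1), E k * X * E k
  have hL : E i * (X + ((q ^ 2 - (q ^ 2)⁻¹) ^ 2)⁻¹ •
        (q⁻¹ • (A * (q • (A * X) - q⁻¹ • (X * A))) - q • ((q • (A * X) - q⁻¹ • (X * A)) * A)))
        * E j
      = (1 + ((q ^ 2 - (q ^ 2)⁻¹) ^ 2)⁻¹ *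
          (θ i ^ 2 - (q ^ 2 + (q ^ 2)⁻¹) * (θ i * θ j) + θ j ^ 2)) • (E i * X * E j) := by
    have h1 : E i * (A * (A * X)) * E j = (θ i ^ 2) • (E i * X * E j) := by
      rw [← mul_assoc, hAl i hi, smul_mul_assoc, ← mul_assoc, hAl i hi]
      simp only [smul_mul_assoc, smul_smul, pow_two]
    have h2 : E i * (A * (X * A)) * E j = (θ i * θ j) • (E i * X * E j) := by
      rw [← mul_assoc, hAl i hi, mul_assoc, mul_assoc, hAr j hj]
      simp only [smul_mul_assoc, mul_smul_comm, smul_smul, mul_assoc, mul_comm (θ j)]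
    have h3 : E i * (X * A * A) * E j = (θ j ^ 2) • (E i * X * E j) := by
      rw [mul_assoc, mul_assoc, hAr j hj, mul_smul_comm, mul_assoc, hAr j hj]
      simp only [mul_smul_comm, smul_smul, mul_assoc, pow_two]
    have h2' : E i * (A * X * A) * E j = (θ i * θ j) • (E i * X * E j) := by
      rw [mul_assoc A X A, h2]
    simp only [mul_add, add_mul, mul_sub, sub_mul, mul_smul_comm, smul_mul_assoc, smul_sub,
      h1, h2, h2', h3, smul_smul]
    match_scalars
    field_simp
    ring
  have hR : E i * ((1 - ((q + q⁻¹) ^ 2)⁻¹ • (A * A)) * D) * E j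
      = (1 - ((q + q⁻¹) ^ 2)⁻¹ * θ i ^ 2) • (E i * D * E j) := by
    have h1 : E i * (1 - ((q + q⁻¹) ^ 2)⁻¹ • (A * A))
        = (1 - ((q + q⁻¹) ^ 2)⁻¹ * θ i ^ 2) • E i := by
      rw [mul_sub, mul_one, mul_smul_comm, ← mul_assoc, hAl i hi, smul_mul_assoc, hAl i hi,
        smul_smul, smul_smul, sub_smul, one_smul, pow_two (θ i), mul_assoc]
    rw [← mul_assoc, h1, smul_mul_assoc, smul_mul_assoc]
  rw [hL, hR, hdiag i hi j hj]
  rcases lt_trichotomy i j with hij | rfl | hij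
  · rw [if_neg hij.ne, smul_zero]
    rcases (Nat.succ_le_of_lt hij).lt_or_eq with h | rfl
    · rw [hX i j hi hj (Or.inl h), smul_zero]
    · obtain ⟨u, v, huv, hs, ht⟩ := hstep i hj
      rw [one_add_quadratic_of_adjacent hq0 hq4 huv hs ht, zero_smul]
  · rw [if_pos rfl, one_add_quadratic_self hq0 hq4]
  · rw [if_neg hij.ne', smul_zero]
    rcases (Nat.succ_le_of_lt hij).lt_or_eq with h | rfl
    · rw [hX i j hi hj (Or.inr h), smul_zero]
    · obtain ⟨u, v, huv, hs, ht⟩ := hstep j hi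
      have h0 := one_add_quadratic_of_adjacent hq0 hq4 huv hs ht
      rw [show θ (j + 1) ^ 2 - (q ^ 2 + (q ^ 2)⁻¹) * (θ (j + 1) * θ j) + θ j ^ 2
          = θ j ^ 2 - (q ^ 2 + (q ^ 2)⁻¹) * (θ j * θ (j + 1)) + θ (j + 1) ^ 2 by ring,
        h0, zero_smul]
end

section
/- Let X ∈ End(V) act tridiagonally on the eigenspaces of A. Then both W^{-1}XW + (qAX − q^{-1}XA)/(q^2 − q^{-2}) = (I + A/(q + q^{-1})) X^∨ and WXW^{-1} + (qXA − q^{-1}AX)/(q^2 − q^{-2}) = (I + A/(q + q^{-1})) X^∨. -/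
section OrthogonalIdempotents

variable {F : Type*} [Field F] {R : Type*} [Ring R] [Algebra F R] {d : ℕ} {E : ℕ → R}

theorem mul_sum_smul_of_orthogonal
    (hEE : ∀ i j : ℕ, i ≤ d → j ≤ d → E i * E j = if i = j then E i else 0)
    (c : ℕ → F) {k : ℕ} (hk : k ≤ d) :
    E k * ∑ i ∈ Finset.range (d + 1), c i • E i = c k • E k := by
  rw [Finset.mul_sum, Finset.sum_eq_single k]
  · simp [hEE k k hk hk]
  · intro i hi hik
    have hi : i ≤ d := by simpa [Nat.lt_succ_iff] using hi
    simp [hEE k i hk hi, hik.symm]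
  · intro h
    exact absurd (Finset.mem_range.2 (Nat.lt_succ_of_le hk)) h

theorem sum_smul_mul_of_orthogonal
    (hEE : ∀ i j : ℕ, i ≤ d → j ≤ d → E i * E j = if i = j then E i else 0)
    (c : ℕ → F) {k : ℕ} (hk : k ≤ d) :
    (∑ i ∈ Finset.range (d + 1), c i • E i) * E k = c k • E k := by
  rw [Finset.sum_mul, Finset.sum_eq_single k]
  · simp [hEE k k hk hk]
  · intro i hi hik
    have hi : i ≤ d := by simpa [Nat.lt_succ_iff] using hi
    simp [hEE i k hi hk, hik]
  · intro h
    exact absurd (Finset.mem_range.2 (Nat.lt_succ_of_le hk)) h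

theorem sum_diagonal_blocks_mul
    (hEE : ∀ i j : ℕ, i ≤ d → j ≤ d → E i * E j = if i = j then E i else 0)
    (X : R) {k : ℕ} (hk : k ≤ d) :
    (∑ i ∈ Finset.range (d + 1), E i * X * E i) * E k = E k * X * E k := by
  rw [Finset.sum_mul, Finset.sum_eq_single k]
  · simp [mul_assoc, hEE k k hk hk]
  · intro i hi hik
    have hi : i ≤ d := by simpa [Nat.lt_succ_iff] using hi
    simp [mul_assoc, hEE i k hi hk, hik]
  · intro h
    exact absurd (Finset.mem_range.2 (Nat.lt_succ_of_le hk)) h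

theorem eq_of_blocks_eq_s3 (hEsum : ∑ i ∈ Finset.range (d + 1), E i = 1) {Y Z : R}
    (h : ∀ i j : ℕ, i ≤ d → j ≤ d → E i * Y * E j = E i * Z * E j) : Y = Z := by
  have expand : ∀ T : R, T = ∑ i ∈ Finset.range (d + 1), ∑ j ∈ Finset.range (d + 1),
      E i * T * E j := by
    intro T
    simp_rw [← Finset.mul_sum, ← Finset.sum_mul, hEsum, one_mul, mul_one]
  rw [expand Y, expand Z]
  refine Finset.sum_congr rfl fun i hi => Finset.sum_congr rfl fun j hj => ?_
  exact h i j (Nat.lt_succ_iff.1 (Finset.mem_range.1 hi)) (Nat.lt_succ_iff.1 (Finset.mem_range.1 hj))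

/-- If `A`, `S`, `T` act on the blocks by scalars `θ`, `s`, `t`, and `X` is tridiagonal, then the
identity for `S * X * T` reduces to scalar identities on the diagonal and adjacent blocks. -/
theorem conj_add_smul_eq_of_tridiagonal
    (hEE : ∀ i j : ℕ, i ≤ d → j ≤ d → E i * E j = if i = j then E i else 0)
    (hEsum : ∑ i ∈ Finset.range (d + 1), E i = 1) {X : R}
    (hX : ∀ i j : ℕ, i ≤ d → j ≤ d → (i + 1 < j ∨ j + 1 < i) → E i * X * E j = 0)
    (θ s t : ℕ → F) (r x y z : F)
    (hdiag : ∀ i ≤ d, s i * t i + r * (x * θ i - y * θ i) = 1 + z * θ i)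
    (hadj : ∀ i j : ℕ, i ≤ d → j ≤ d → (j = i + 1 ∨ i = j + 1) →
      s i * t j + r * (x * θ i - y * θ j) = 0) :
    (∑ i ∈ Finset.range (d + 1), s i • E i) * X * (∑ i ∈ Finset.range (d + 1), t i • E i)
      + r • (x • ((∑ i ∈ Finset.range (d + 1), θ i • E i) * X)
        - y • (X * ∑ i ∈ Finset.range (d + 1), θ i • E i))
      = (1 + z • ∑ i ∈ Finset.range (d + 1), θ i • E i)
        * ∑ i ∈ Finset.range (d + 1), E i * X * E i := by
  refine eq_of_blocks_eq_s3 hEsum fun i j hi hj => ?_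
  have hleft (c : ℕ → F) := mul_sum_smul_of_orthogonal hEE c hi
  have hright (c : ℕ → F) := sum_smul_mul_of_orthogonal hEE c hj
  have hD := sum_diagonal_blocks_mul hEE X hj
  have hlhs : E i * ((∑ i ∈ Finset.range (d + 1), s i • E i) * X
        * (∑ i ∈ Finset.range (d + 1), t i • E i)
      + r • (x • ((∑ i ∈ Finset.range (d + 1), θ i • E i) * X)
        - y • (X * ∑ i ∈ Finset.range (d + 1), θ i • E i))) * E j
      = (s i * t j + r * (x * θ i - y * θ j)) • (E i * X * E j) := by
    have h₁ : E i * ((∑ i ∈ Finset.range (d + 1), s i • E i) * X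
        * (∑ i ∈ Finset.range (d + 1), t i • E i)) * E j = (s i * t j) • (E i * X * E j) := by
      rw [mul_assoc, mul_assoc, hright, ← mul_assoc, ← mul_assoc, hleft]
      simp [smul_smul, mul_comm]
    have h₂ : E i * ((∑ i ∈ Finset.range (d + 1), θ i • E i) * X) * E j
        = θ i • (E i * X * E j) := by
      rw [← mul_assoc, hleft]
      simp
    have h₃ : E i * (X * ∑ i ∈ Finset.range (d + 1), θ i • E i) * E j
        = θ j • (E i * X * E j) := by
      rw [mul_assoc, mul_assoc, hright]
      simp [mul_assoc]
    rw [mul_add, add_mul, h₁, mul_smul_comm, smul_mul_assoc, mul_sub, sub_mul, mul_smul_comm,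
      mul_smul_comm, smul_mul_assoc, smul_mul_assoc, h₂, h₃]
    module
  have hrhs : E i * ((1 + z • ∑ i ∈ Finset.range (d + 1), θ i • E i)
        * ∑ i ∈ Finset.range (d + 1), E i * X * E i) * E j
      = (1 + z * θ i) • (E i * E j * X * E j) := by
    have h : E i * (1 + z • ∑ i ∈ Finset.range (d + 1), θ i • E i) = (1 + z * θ i) • E i := by
      rw [mul_add, mul_one, mul_smul_comm, hleft]
      module
    rw [mul_assoc, mul_assoc, hD, ← mul_assoc, h]
    simp [mul_assoc]
  rw [hlhs, hrhs, hEE i j hi hj]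
  by_cases hij : i = j
  · subst hij
    simp [hdiag i hi]
  · rw [if_neg hij]
    by_cases hadjacent : j = i + 1 ∨ i = j + 1
    · simp [hadj i j hi hj hadjacent]
    · simp [hX i j hi hj (by omega)]

end OrthogonalIdempotents

section Scalars

variable {F : Type*} [Field F] {q a : F} {d : ℕ} {θ t : ℕ → F}

theorem sq_sub_inv_sq_ne_zero (hq0 : q ≠ 0) (hq4 : q ^ 4 ≠ 1) : q ^ 2 - (q ^ 2)⁻¹ ≠ 0 := by
  intro h
  apply hq4
  field_simp at h
  linear_combination h

theorem inv_sq_sub_inv_sq_mul_sub_inv (hq0 : q ≠ 0) (hq4 : q ^ 4 ≠ 1) :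
    (q ^ 2 - (q ^ 2)⁻¹)⁻¹ * (q - q⁻¹) = (q + q⁻¹)⁻¹ := by
  have h := sq_sub_inv_sq_ne_zero hq0 hq4
  have hfactor : q ^ 2 - (q ^ 2)⁻¹ = (q - q⁻¹) * (q + q⁻¹) := by
    field_simp
    ring
  rw [hfactor] at h ⊢
  have := left_ne_zero_of_mul h
  rw [mul_inv, mul_right_comm, inv_mul_cancel₀ this, one_mul]

theorem t_ne_zero (hq0 : q ≠ 0) (ha0 : a ≠ 0)
    (ht : ∀ i : ℕ, i ≤ d → t i = (-1 : F) ^ i * a ^ i * q ^ (i * (d - i))) {i : ℕ} (hi : i ≤ d) :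
    t i ≠ 0 := by
  rw [ht i hi]
  simp [hq0, ha0]

/-- The adjacent off-diagonal scalars vanish. -/
theorem t_ratio_add_eq_zero (hq0 : q ≠ 0) (ha0 : a ≠ 0) (hq4 : q ^ 4 ≠ 1)
    (hθ : ∀ i : ℕ, i ≤ d →
      θ i = a * q ^ ((d : ℤ) - 2 * (i : ℤ)) + a⁻¹ * q ^ (2 * (i : ℤ) - (d : ℤ)))
    (ht : ∀ i : ℕ, i ≤ d → t i = (-1 : F) ^ i * a ^ i * q ^ (i * (d - i)))
    {i j : ℕ} (hi : i ≤ d) (hj : j ≤ d) (hij : j = i + 1 ∨ i = j + 1) :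
    (t i)⁻¹ * t j + (q ^ 2 - (q ^ 2)⁻¹)⁻¹ * (q * θ i - q⁻¹ * θ j) = 0 := by
  have hr := sq_sub_inv_sq_ne_zero hq0 hq4
  have key : ∀ i, i + 1 ≤ d → ∃ u : F, u ≠ 0 ∧ t (i + 1) = -(a * u * t i) ∧
      θ i = a * u * q + a⁻¹ * u⁻¹ * q⁻¹ ∧ θ (i + 1) = a * u * q⁻¹ + a⁻¹ * u⁻¹ * q := by
    intro i hi
    obtain ⟨k, rfl⟩ := Nat.exists_eq_add_of_le hi
    refine ⟨q ^ ((k : ℤ) - i), zpow_ne_zero _ hq0, ?_, ?_, ?_⟩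
    · rw [ht _ hi, ht i (by omega), show i + 1 + k - (i + 1) = k by omega,
        show i + 1 + k - i = k + 1 by omega, zpow_sub₀ hq0, zpow_natCast, zpow_natCast]
      field_simp
      ring
    · rw [hθ i (by omega), mul_assoc, ← zpow_add_one₀ hq0, ← zpow_neg, mul_assoc,
        ← zpow_sub_one₀ hq0]
      push_cast
      ring_nf
    · rw [hθ _ hi, mul_assoc, ← zpow_sub_one₀ hq0, ← zpow_neg, mul_assoc, ← zpow_add_one₀ hq0]
      push_cast
      ring_nf
  rcases hij with rfl | rfl
  · obtain ⟨u, hu, h₁, h₂, h₃⟩ := key i hj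
    have hti := t_ne_zero hq0 ha0 ht hi
    have hdiff : q * θ i - q⁻¹ * θ (i + 1) = (q ^ 2 - (q ^ 2)⁻¹) * (a * u) := by
      rw [h₂, h₃]
      field_simp
      ring
    rw [hdiff, inv_mul_cancel_left₀ hr, h₁]
    field_simp
    ring
  · obtain ⟨u, hu, h₁, h₂, h₃⟩ := key j hi
    have htj := t_ne_zero hq0 ha0 ht hj
    have hdiff : q * θ (j + 1) - q⁻¹ * θ j = (q ^ 2 - (q ^ 2)⁻¹) * (a * u)⁻¹ := by
      rw [h₂, h₃]
      field_simp
      ring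
    rw [hdiff, inv_mul_cancel_left₀ hr, h₁]
    field_simp
    ring

end Scalars

theorem stmt3
    {F : Type*} [Field F] {V : Type*} [AddCommGroup V] [Module F V]
    [FiniteDimensional F V] [Nontrivial V]
    (q a : F) (hq0 : q ≠ 0) (ha0 : a ≠ 0) (hq4 : q ^ 4 ≠ 1)
    (d : ℕ) (hd : 1 ≤ d)
    (hq2i : ∀ i : ℕ, 1 ≤ i → i ≤ d → q ^ (2 * i) ≠ 1)
    (ha2 : ∀ j : ℤ, 1 - (d : ℤ) ≤ j → j ≤ (d : ℤ) - 1 → a ^ 2 ≠ q ^ (2 * j))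
    (θ : ℕ → F)
    (hθ : ∀ i : ℕ, i ≤ d → θ i = a * q ^ ((d : ℤ) - 2 * (i : ℤ)) + a⁻¹ * q ^ (2 * (i : ℤ) - (d : ℤ)))
    (hθdist : ∀ i j : ℕ, i ≤ d → j ≤ d → i ≠ j → θ i ≠ θ j)
    (A : Module.End F V) (E : ℕ → Module.End F V)
    (hEE : ∀ i j : ℕ, i ≤ d → j ≤ d → E i * E j = if i = j then E i else 0)
    (hEsum : ∑ i ∈ Finset.range (d + 1), E i = 1)
    (hAE : A = ∑ i ∈ Finset.range (d + 1), θ i • E i)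
    (hEne : ∀ i : ℕ, i ≤ d → E i ≠ 0)
    (t : ℕ → F)
    (ht : ∀ i : ℕ, i ≤ d → t i = (-1 : F) ^ i * a ^ i * q ^ (i * (d - i)))
    (W Winv : Module.End F V)
    (hW : W = ∑ i ∈ Finset.range (d + 1), t i • E i)
    (hWinv : Winv = ∑ i ∈ Finset.range (d + 1), (t i)⁻¹ • E i)
    (X : Module.End F V)
    (hX : (∀ i j : ℕ, i ≤ d → j ≤ d → (i + 1 < j ∨ j + 1 < i) → E i * X * E j = 0)) :
    Winv * X * W + (q ^ 2 - (q ^ 2)⁻¹)⁻¹ • (q • (A * X) - q⁻¹ • (X * A))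
      = (1 + (q + q⁻¹)⁻¹ • A) * (∑ i ∈ Finset.range (d + 1), E i * X * E i) ∧
    W * X * Winv + (q ^ 2 - (q ^ 2)⁻¹)⁻¹ • (q • (X * A) - q⁻¹ • (A * X))
      = (1 + (q + q⁻¹)⁻¹ • A) * (∑ i ∈ Finset.range (d + 1), E i * X * E i) := by
  have hr := inv_sq_sub_inv_sq_mul_sub_inv hq0 hq4
  have hadj (i j : ℕ) (hi : i ≤ d) (hj : j ≤ d) (hij : j = i + 1 ∨ i = j + 1) :=
    t_ratio_add_eq_zero hq0 ha0 hq4 hθ ht hi hj hij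
  have hdiag : ∀ i ≤ d, (t i)⁻¹ * t i = 1 := fun i hi =>
    inv_mul_cancel₀ (t_ne_zero hq0 ha0 ht hi)
  constructor
  · rw [hW, hWinv, hAE]
    refine conj_add_smul_eq_of_tridiagonal hEE hEsum hX θ _ _ _ _ _ _ (fun i hi => ?_) hadj
    linear_combination hdiag i hi + θ i * hr
  · have hswap : q • (X * A) - q⁻¹ • (A * X) = (-q⁻¹) • (A * X) - (-q) • (X * A) := by
      module
    rw [hswap, hW, hWinv, hAE]
    refine conj_add_smul_eq_of_tridiagonal hEE hEsum hX θ _ _ _ _ _ _ (fun i hi => ?_)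
      fun i j hi hj hij => ?_
    · linear_combination hdiag i hi + θ i * hr
    · linear_combination hadj j i hj hi hij.symm
end

section
/- Let X ∈ End(V) act tridiagonally on the eigenspaces of A. Then WXW^{-1} − W^{-1}XW = [A, X]/(q − q^{-1}). -/
theorem sum_smul_mul_mul_sum_smul {R M : Type*} [CommSemiring R] [Semiring M] [Algebra R M]
    (s : Finset ℕ) (u v : ℕ → R) (E : ℕ → M) (X : M) :
    (∑ i ∈ s, u i • E i) * X * (∑ j ∈ s, v j • E j) =
      ∑ i ∈ s, ∑ j ∈ s, (u i * v j) • (E i * X * E j) := by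
  rw [Finset.sum_mul, Finset.sum_mul_sum]
  refine Finset.sum_congr rfl fun i _ => Finset.sum_congr rfl fun j _ => ?_
  rw [smul_mul_assoc, smul_mul_smul_comm]

theorem sub_inv_ne_zero_of_pow_four_ne_one {F : Type*} [Field F] {q : F} (hq0 : q ≠ 0)
    (hq4 : q ^ 4 ≠ 1) : q - q⁻¹ ≠ 0 := by
  intro h
  have h2 : q * q = 1 := by
    nth_rewrite 2 [sub_eq_zero.mp h]
    exact mul_inv_cancel₀ hq0
  exact hq4 (by linear_combination (q * q + 1) * h2)

/-- The ratio of consecutive terms of the sequence `(-1)^i a^i q^(i(d-i))`. -/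
theorem neg_one_pow_mul_succ {F : Type*} [Field F] {q : F} (a : F) (hq0 : q ≠ 0)
    {d i : ℕ} (hi : i + 1 ≤ d) :
    (-1 : F) ^ (i + 1) * a ^ (i + 1) * q ^ ((i + 1) * (d - (i + 1))) =
      -(a * q ^ ((d : ℤ) - 2 * i - 1)) * ((-1 : F) ^ i * a ^ i * q ^ (i * (d - i))) := by
  have h : q ^ ((i + 1) * (d - (i + 1))) =
      q ^ ((d : ℤ) - 2 * i - 1) * q ^ (i * (d - i)) := by
    rw [← zpow_natCast, ← zpow_natCast, ← zpow_add₀ hq0]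
    congr 1
    push_cast [Nat.cast_sub hi, Nat.cast_sub (Nat.le_of_succ_le hi)]
    ring
  rw [h]
  ring


theorem stmt4
    {F : Type*} [Field F] {V : Type*} [AddCommGroup V] [Module F V]
    [FiniteDimensional F V] [Nontrivial V]
    (q a : F) (hq0 : q ≠ 0) (ha0 : a ≠ 0) (hq4 : q ^ 4 ≠ 1)
    (d : ℕ) (hd : 1 ≤ d)
    (hq2i : ∀ i : ℕ, 1 ≤ i → i ≤ d → q ^ (2 * i) ≠ 1)
    (ha2 : ∀ j : ℤ, 1 - (d : ℤ) ≤ j → j ≤ (d : ℤ) - 1 → a ^ 2 ≠ q ^ (2 * j))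
    (θ : ℕ → F)
    (hθ : ∀ i : ℕ, i ≤ d → θ i = a * q ^ ((d : ℤ) - 2 * (i : ℤ)) + a⁻¹ * q ^ (2 * (i : ℤ) - (d : ℤ)))
    (hθdist : ∀ i j : ℕ, i ≤ d → j ≤ d → i ≠ j → θ i ≠ θ j)
    (A : Module.End F V) (E : ℕ → Module.End F V)
    (hEE : ∀ i j : ℕ, i ≤ d → j ≤ d → E i * E j = if i = j then E i else 0)
    (hEsum : ∑ i ∈ Finset.range (d + 1), E i = 1)
    (hAE : A = ∑ i ∈ Finset.range (d + 1), θ i • E i)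
    (hEne : ∀ i : ℕ, i ≤ d → E i ≠ 0)
    (t : ℕ → F)
    (ht : ∀ i : ℕ, i ≤ d → t i = (-1 : F) ^ i * a ^ i * q ^ (i * (d - i)))
    (W Winv : Module.End F V)
    (hW : W = ∑ i ∈ Finset.range (d + 1), t i • E i)
    (hWinv : Winv = ∑ i ∈ Finset.range (d + 1), (t i)⁻¹ • E i)
    (X : Module.End F V)
    (hX : (∀ i j : ℕ, i ≤ d → j ≤ d → (i + 1 < j ∨ j + 1 < i) → E i * X * E j = 0)) :
    W * X * Winv - Winv * X * W = (q - q⁻¹)⁻¹ • (A * X - X * A) := by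
  have hqq := sub_inv_ne_zero_of_pow_four_ne_one hq0 hq4
  have ht0 : ∀ i ≤ d, t i ≠ 0 := fun i hi => by
    rw [ht i hi]
    simp [ha0, hq0]
  have key : ∀ i, i + 1 ≤ d →
      t i * (t (i + 1))⁻¹ - (t i)⁻¹ * t (i + 1) = (q - q⁻¹)⁻¹ * (θ i - θ (i + 1)) := by
    intro i hi
    have hti := ht0 i (by omega)
    have hsucc : t (i + 1) = -(a * q ^ ((d : ℤ) - 2 * i - 1)) * t i := by
      rw [ht _ hi, ht i (by omega), neg_one_pow_mul_succ a hq0 hi]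
    rw [hsucc, hθ i (by omega), hθ _ hi, eq_inv_mul_iff_mul_eq₀ hqq]
    set z := q ^ ((d : ℤ) - 2 * i - 1) with hz
    have hz0 : z ≠ 0 := zpow_ne_zero _ hq0
    have e1 : q ^ ((d : ℤ) - 2 * i) = z * q := by
      rw [hz, ← zpow_add_one₀ hq0]; congr 1; ring
    have e2 : q ^ (2 * (i : ℤ) - d) = z⁻¹ * q⁻¹ := by
      rw [← mul_inv, ← e1, ← zpow_neg]; congr 1; ring
    have e3 : q ^ ((d : ℤ) - 2 * ((i + 1 : ℕ) : ℤ)) = z * q⁻¹ := by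
      rw [hz, ← zpow_sub_one₀ hq0]; congr 1; push_cast; ring
    have e4 : q ^ (2 * ((i + 1 : ℕ) : ℤ) - d) = z⁻¹ * q := by
      rw [← inv_inv q, ← mul_inv, inv_inv, ← e3, ← zpow_neg]; congr 1; ring
    rw [e1, e2, e3, e4]
    field_simp
    ring
  have hone : (1 : Module.End F V) = ∑ i ∈ Finset.range (d + 1), (1 : F) • E i := by
    simp [hEsum]
  have hAX : A * X = A * X * 1 := (mul_one _).symm
  have hXA : X * A = 1 * X * A := by rw [one_mul]
  rw [hAX, hXA, hW, hWinv, hAE, hone]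
  simp only [sum_smul_mul_mul_sum_smul, ← Finset.sum_sub_distrib, Finset.smul_sum]
  refine Finset.sum_congr rfl fun i hi => Finset.sum_congr rfl fun j hj => ?_
  have hi : i ≤ d := Finset.mem_range_succ_iff.mp hi
  have hj : j ≤ d := Finset.mem_range_succ_iff.mp hj
  rw [← sub_smul, ← sub_smul, smul_smul, mul_one, one_mul]
  by_cases hfar : i + 1 < j ∨ j + 1 < i
  · rw [hX i j hi hj hfar, smul_zero, smul_zero]
  congr 1
  obtain rfl | rfl | rfl : j = i ∨ j = i + 1 ∨ i = j + 1 := by omega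
  · rw [mul_comm, sub_self, sub_self, mul_zero]
  · exact key i hj
  · linear_combination -key j hi
end

section
/- Let X, Y ∈ End(V) be such that X acts tridiagonally on the eigenspaces of A and A commutes with Y + (qXA − q^{-1}AX)/(q^2 − q^{-2}). Then WXW^{-1} − Y = X − W^{-1}YW, and this common value commutes with A. -/
section IdempotentSystem

variable {F R : Type*} [Field F] [Ring R] [Algebra F R] {d : ℕ} {E : ℕ → R}

theorem idempotent_mul_sum_smul
    (hEE : ∀ i j : ℕ, i ≤ d → j ≤ d → E i * E j = if i = j then E i else 0)
    (f : ℕ → F) {i : ℕ} (hi : i ≤ d) :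
    E i * ∑ j ∈ Finset.range (d + 1), f j • E j = f i • E i := by
  rw [Finset.mul_sum, Finset.sum_eq_single i]
  · simp [hEE i i hi hi]
  · intro j hj hji
    have hj' : j ≤ d := by simpa [Nat.lt_succ_iff] using hj
    simp [hEE i j hi hj', hji.symm]
  · intro h
    exact absurd (Finset.mem_range.2 (by omega)) h

theorem sum_smul_mul_idempotent
    (hEE : ∀ i j : ℕ, i ≤ d → j ≤ d → E i * E j = if i = j then E i else 0)
    (f : ℕ → F) {i : ℕ} (hi : i ≤ d) :
    (∑ j ∈ Finset.range (d + 1), f j • E j) * E i = f i • E i := by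
  rw [Finset.sum_mul, Finset.sum_eq_single i]
  · simp [hEE i i hi hi]
  · intro j hj hji
    have hj' : j ≤ d := by simpa [Nat.lt_succ_iff] using hj
    simp [hEE j i hj' hi, hji]
  · intro h
    exact absurd (Finset.mem_range.2 (by omega)) h

theorem eq_of_forall_idempotent_mul_mul (hEsum : ∑ i ∈ Finset.range (d + 1), E i = 1)
    {M N : R} (h : ∀ i j : ℕ, i ≤ d → j ≤ d → E i * M * E j = E i * N * E j) : M = N := by
  have expand : ∀ Z : R, Z = ∑ i ∈ Finset.range (d + 1), ∑ j ∈ Finset.range (d + 1),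
      E i * Z * E j := by
    intro Z
    simp_rw [← Finset.mul_sum, hEsum, mul_one, ← Finset.sum_mul, hEsum, one_mul]
  rw [expand M, expand N]
  refine Finset.sum_congr rfl fun i hi => Finset.sum_congr rfl fun j hj => ?_
  rw [Finset.mem_range] at hi hj
  exact h i j (by omega) (by omega)

theorem idempotent_mul_sum_mul_sum_mul
    (hEE : ∀ i j : ℕ, i ≤ d → j ≤ d → E i * E j = if i = j then E i else 0)
    (f g : ℕ → F) (M : R) {i j : ℕ} (hi : i ≤ d) (hj : j ≤ d) :
    E i * ((∑ k ∈ Finset.range (d + 1), f k • E k) * M *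
      ∑ k ∈ Finset.range (d + 1), g k • E k) * E j = (f i * g j) • (E i * M * E j) := by
  rw [mul_assoc (E i), mul_assoc _ _ (E j), sum_smul_mul_idempotent hEE g hj, ← mul_assoc,
    ← mul_assoc, idempotent_mul_sum_smul hEE f hi, smul_mul_assoc, smul_mul_assoc, mul_smul_comm,
    smul_smul]

end IdempotentSystem

section Scalars

variable {F : Type*} [Field F] {q a : F} {d : ℕ} {θ t : ℕ → F}

theorem t_succ (hq0 : q ≠ 0)
    (ht : ∀ i : ℕ, i ≤ d → t i = (-1 : F) ^ i * a ^ i * q ^ (i * (d - i)))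
    {i : ℕ} (hi : i + 1 ≤ d) : t (i + 1) = -a * q ^ ((d : ℤ) - 2 * i - 1) * t i := by
  have hexp : q ^ ((i + 1) * (d - (i + 1))) = q ^ ((d : ℤ) - 2 * i - 1) * q ^ (i * (d - i)) := by
    rw [← zpow_natCast, ← zpow_natCast, ← zpow_add₀ hq0]
    congr 1
    push_cast [Nat.cast_sub hi, Nat.cast_sub (show i ≤ d by omega)]
    ring
  rw [ht _ hi, ht _ (by omega), hexp]
  ring

theorem t_mul_inv_adjacent (hq0 : q ≠ 0) (ha0 : a ≠ 0) (hq4 : q ^ 4 ≠ 1)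
    (hθ : ∀ i : ℕ, i ≤ d →
      θ i = a * q ^ ((d : ℤ) - 2 * (i : ℤ)) + a⁻¹ * q ^ (2 * (i : ℤ) - (d : ℤ)))
    (ht : ∀ i : ℕ, i ≤ d → t i = (-1 : F) ^ i * a ^ i * q ^ (i * (d - i)))
    {i j : ℕ} (hi : i ≤ d) (hj : j ≤ d) (hij : j = i + 1 ∨ i = j + 1) :
    t i * (t j)⁻¹ = -((q ^ 2 - (q ^ 2)⁻¹)⁻¹ * (q * θ j - q⁻¹ * θ i)) := by
  have hk := sq_sub_inv_sq_ne_zero hq0 hq4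
  have hz : ∀ m : ℕ, q ^ ((d : ℤ) - 2 * m) ≠ 0 := fun m => zpow_ne_zero _ hq0
  have hneg : ∀ m : ℕ, q ^ (2 * (m : ℤ) - d) = (q ^ ((d : ℤ) - 2 * m))⁻¹ := fun m => by
    rw [← zpow_neg, neg_sub]
  have hsucc : ∀ m : ℕ, q ^ ((d : ℤ) - 2 * (m + 1 : ℕ)) = q ^ ((d : ℤ) - 2 * m) / q ^ 2 :=
    fun m => by
      rw [← zpow_natCast q 2, ← zpow_sub₀ hq0]
      congr 1
      push_cast
      ring
  have hpred : ∀ m : ℕ, q ^ ((d : ℤ) - 2 * m - 1) = q ^ ((d : ℤ) - 2 * m) / q :=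
    fun m => by rw [zpow_sub_one₀ hq0, div_eq_mul_inv]
  rw [neg_mul_eq_mul_neg, eq_inv_mul_iff_mul_eq₀ hk]
  rcases hij with rfl | rfl
  · have hti := t_ne_zero hq0 ha0 ht hi
    have hzi := hz i
    rw [t_succ hq0 ht hj, hθ _ hi, hθ _ hj, hneg, hneg, hsucc, hpred]
    generalize q ^ ((d : ℤ) - 2 * i) = z at *
    field_simp
    ring
  · have htj := t_ne_zero hq0 ha0 ht hj
    have hzj := hz j
    rw [t_succ hq0 ht hi, hθ _ hi, hθ _ hj, hneg, hneg, hsucc, hpred]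
    generalize q ^ ((d : ℤ) - 2 * j) = z at *
    field_simp
    ring

end Scalars


theorem stmt6
    {F : Type*} [Field F] {V : Type*} [AddCommGroup V] [Module F V]
    [FiniteDimensional F V] [Nontrivial V]
    (q a : F) (hq0 : q ≠ 0) (ha0 : a ≠ 0) (hq4 : q ^ 4 ≠ 1)
    (d : ℕ) (hd : 1 ≤ d)
    (hq2i : ∀ i : ℕ, 1 ≤ i → i ≤ d → q ^ (2 * i) ≠ 1)
    (ha2 : ∀ j : ℤ, 1 - (d : ℤ) ≤ j → j ≤ (d : ℤ) - 1 → a ^ 2 ≠ q ^ (2 * j))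
    (θ : ℕ → F)
    (hθ : ∀ i : ℕ, i ≤ d → θ i = a * q ^ ((d : ℤ) - 2 * (i : ℤ)) + a⁻¹ * q ^ (2 * (i : ℤ) - (d : ℤ)))
    (hθdist : ∀ i j : ℕ, i ≤ d → j ≤ d → i ≠ j → θ i ≠ θ j)
    (A : Module.End F V) (E : ℕ → Module.End F V)
    (hEE : ∀ i j : ℕ, i ≤ d → j ≤ d → E i * E j = if i = j then E i else 0)
    (hEsum : ∑ i ∈ Finset.range (d + 1), E i = 1)
    (hAE : A = ∑ i ∈ Finset.range (d + 1), θ i • E i)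
    (hEne : ∀ i : ℕ, i ≤ d → E i ≠ 0)
    (t : ℕ → F)
    (ht : ∀ i : ℕ, i ≤ d → t i = (-1 : F) ^ i * a ^ i * q ^ (i * (d - i)))
    (W Winv : Module.End F V)
    (hW : W = ∑ i ∈ Finset.range (d + 1), t i • E i)
    (hWinv : Winv = ∑ i ∈ Finset.range (d + 1), (t i)⁻¹ • E i)
    (X Y : Module.End F V)
    (hX : (∀ i j : ℕ, i ≤ d → j ≤ d → (i + 1 < j ∨ j + 1 < i) → E i * X * E j = 0))
    (hcomm : A * (Y + (q ^ 2 - (q ^ 2)⁻¹)⁻¹ • (q • (X * A) - q⁻¹ • (A * X)))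
        = (Y + (q ^ 2 - (q ^ 2)⁻¹)⁻¹ • (q • (X * A) - q⁻¹ • (A * X))) * A) :
    W * X * Winv - Y = X - Winv * Y * W ∧
    A * (W * X * Winv - Y) = (W * X * Winv - Y) * A := by
  set k := (q ^ 2 - (q ^ 2)⁻¹)⁻¹
  have hAl : ∀ i, i ≤ d → E i * A = θ i • E i := fun i hi =>
    hAE ▸ idempotent_mul_sum_smul hEE θ hi
  have hAr : ∀ i, i ≤ d → A * E i = θ i • E i := fun i hi =>
    hAE ▸ sum_smul_mul_idempotent hEE θ hi
  have hlA : ∀ M : Module.End F V, ∀ i j, i ≤ d → j ≤ d →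
      E i * (A * M) * E j = θ i • (E i * M * E j) := fun M i j hi hj => by
    rw [← mul_assoc, hAl i hi, smul_mul_assoc, smul_mul_assoc]
  have hrA : ∀ M : Module.End F V, ∀ i j, i ≤ d → j ≤ d →
      E i * (M * A) * E j = θ j • (E i * M * E j) := fun M i j hi hj => by
    rw [mul_assoc, mul_assoc, hAr j hj, mul_smul_comm, mul_smul_comm, ← mul_assoc]
  have hY : ∀ i j, i ≤ d → j ≤ d → i ≠ j →
      E i * Y * E j = -(k * (q * θ j - q⁻¹ * θ i)) • (E i * X * E j) := by
    intro i j hi hj hij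
    have h := congrArg (fun M => E i * M * E j) hcomm
    simp only [hlA _ i j hi hj, hrA _ i j hi hj] at h
    have h0 := (smul_eq_zero.1 ((sub_smul _ _ _).trans (sub_eq_zero.2 h))).resolve_left
      (sub_ne_zero.2 (hθdist i j hi hj hij))
    simp only [mul_add, add_mul, mul_sub, sub_mul, mul_smul_comm, smul_mul_assoc] at h0
    simp only [hlA _ i j hi hj, hrA _ i j hi hj] at h0
    rw [eq_neg_of_add_eq_zero_left h0]
    module
  have hWX : ∀ i j, i ≤ d → j ≤ d →
      E i * (W * X * Winv) * E j = (t i * (t j)⁻¹) • (E i * X * E j) := fun i j hi hj => by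
    rw [hW, hWinv]
    exact idempotent_mul_sum_mul_sum_mul hEE t (fun i => (t i)⁻¹) X hi hj
  have hWY : ∀ i j, i ≤ d → j ≤ d →
      E i * (Winv * Y * W) * E j = ((t i)⁻¹ * t j) • (E i * Y * E j) := fun i j hi hj => by
    rw [hW, hWinv]
    exact idempotent_mul_sum_mul_sum_mul hEE (fun i => (t i)⁻¹) t Y hi hj
  have ht0 : ∀ i, i ≤ d → t i ≠ 0 := fun i hi => t_ne_zero hq0 ha0 ht hi
  have hWXY : ∀ i j, i ≤ d → j ≤ d → i ≠ j →
      E i * Y * E j = (t i * (t j)⁻¹) • (E i * X * E j) := by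
    intro i j hi hj hij
    rw [hY i j hi hj hij]
    by_cases hadj : j = i + 1 ∨ i = j + 1
    · rw [t_mul_inv_adjacent hq0 ha0 hq4 hθ ht hi hj hadj]
    · rw [hX i j hi hj (by omega), smul_zero, smul_zero]
  constructor
  · refine eq_of_forall_idempotent_mul_mul hEsum fun i j hi hj => ?_
    have hti := ht0 i hi
    have htj := ht0 j hj
    rw [mul_sub, mul_sub, sub_mul, sub_mul, hWX i j hi hj, hWY i j hi hj]
    rcases eq_or_ne i j with rfl | hij
    · rw [mul_inv_cancel₀ hti, inv_mul_cancel₀ hti, one_smul, one_smul]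
    · rw [hWXY i j hi hj hij, smul_smul,
        show (t i)⁻¹ * t j * (t i * (t j)⁻¹) = 1 by field_simp, one_smul, sub_self, sub_self]
  · refine eq_of_forall_idempotent_mul_mul hEsum fun i j hi hj => ?_
    rw [hlA _ i j hi hj, hrA _ i j hi hj]
    rcases eq_or_ne i j with rfl | hij
    · rfl
    · rw [mul_sub, sub_mul, hWX i j hi hj, hWXY i j hi hj hij, sub_self, smul_zero, smul_zero]
end

section
/- For all integers r, s with 0 ≤ r ≤ s ≤ d, the following two identities hold in F: t_s/t_r = Σ_{i=0}^{s−r} (−1)^i q^{i^2} (θ_s − θ_r)(θ_s − θ_{r+1})⋯(θ_s − θ_{r+i−1}) / ((q^2; q^2)_i (a^{−1}q^{2r+1−d}; q^2)_i), and t_r/t_s = Σ_{i=0}^{s−r} (−1)^i q^{−i^2} (θ_s − θ_r)(θ_s − θ_{r+1})⋯(θ_s − θ_{r+i−1}) / ((q^{−2}; q^{−2})_i (a q^{d−2r−1}; q^{−2})_i). (All denominators are nonzero under the stated assumptions.) -/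
/-- The `q`-Chu–Vandermonde summation, in a form free of division by the numerator parameters. -/
theorem sum_prod_qChuVandermonde {F : Type*} [Field F] (Q e : F) (n : ℕ) :
    ∀ c : F, (∀ k < n, 1 - Q * Q ^ k ≠ 0) → (∀ k < n, 1 - c * Q ^ k ≠ 0) →
      ∑ i ∈ Finset.range (n + 1), (∏ k ∈ Finset.range i, (Q ^ n - Q ^ k) * (e - c * Q ^ k)) /
          ((∏ k ∈ Finset.range i, (1 - Q * Q ^ k)) * ∏ k ∈ Finset.range i, (1 - c * Q ^ k)) =
        ∏ k ∈ Finset.range n, (1 - e * Q ^ k) / (1 - c * Q ^ k) := by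
  induction n with
  | zero => intro c _ _; simp
  | succ n ih =>
    intro c hQ hc
    have hQ' : ∀ k < n, 1 - Q * Q ^ k ≠ 0 := fun k hk => hQ k (by omega)
    have ih₁ := ih c hQ' fun k hk => hc k (by omega)
    have ih₂ := ih (c * Q) hQ' fun k hk => by
      have := hc (k + 1) (by omega)
      rwa [pow_succ', ← mul_assoc] at this
    have hc₀ : 1 - c ≠ 0 := by simpa using hc 0 (by omega)
    have shift : ∀ f : F → F, ∀ j, ∏ k ∈ Finset.range (j + 1), f (c * Q ^ k) =
        f c * ∏ k ∈ Finset.range j, f (c * Q * Q ^ k) := by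
      intro f j
      rw [Finset.prod_range_succ', mul_comm]
      simp [pow_succ', mul_assoc]
    have pascal : ∀ j, ∏ k ∈ Finset.range (j + 1), (Q ^ (n + 1) - Q ^ k) =
        (∏ k ∈ Finset.range (j + 1), (Q ^ n - Q ^ k)) -
          Q ^ n * (1 - Q * Q ^ j) * ∏ k ∈ Finset.range j, (Q ^ n - Q ^ k) := by
      intro j
      have hshift : ∏ k ∈ Finset.range j, (Q ^ (n + 1) - Q ^ (k + 1)) =
          Q ^ j * ∏ k ∈ Finset.range j, (Q ^ n - Q ^ k) := by
        rw [← Finset.card_range j, ← Finset.prod_const, Finset.card_range,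
          ← Finset.prod_mul_distrib]
        exact Finset.prod_congr rfl fun k _ => by ring
      rw [Finset.prod_range_succ', hshift, Finset.prod_range_succ]
      ring
    have term : ∀ j ∈ Finset.range (n + 1),
        (∏ k ∈ Finset.range (j + 1), (Q ^ (n + 1) - Q ^ k) * (e - c * Q ^ k)) /
          ((∏ k ∈ Finset.range (j + 1), (1 - Q * Q ^ k)) *
            ∏ k ∈ Finset.range (j + 1), (1 - c * Q ^ k)) =
        (∏ k ∈ Finset.range (j + 1), (Q ^ n - Q ^ k) * (e - c * Q ^ k)) /
          ((∏ k ∈ Finset.range (j + 1), (1 - Q * Q ^ k)) *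
            ∏ k ∈ Finset.range (j + 1), (1 - c * Q ^ k)) -
        Q ^ n * (e - c) / (1 - c) *
          ((∏ k ∈ Finset.range j, (Q ^ n - Q ^ k) * (e - c * Q * Q ^ k)) /
            ((∏ k ∈ Finset.range j, (1 - Q * Q ^ k)) *
              ∏ k ∈ Finset.range j, (1 - c * Q * Q ^ k))) := by
      intro j hj
      have hj' : j < n + 1 := Finset.mem_range.1 hj
      have hA : ∏ k ∈ Finset.range j, (1 - Q * Q ^ k) ≠ 0 :=
        Finset.prod_ne_zero_iff.2 fun k hk => hQ k (by have := Finset.mem_range.1 hk; omega)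
      have hB : ∏ k ∈ Finset.range (j + 1), (1 - c * Q ^ k) ≠ 0 :=
        Finset.prod_ne_zero_iff.2 fun k hk => hc k (by have := Finset.mem_range.1 hk; omega)
      have hj₀ := hQ j hj'
      simp only [Finset.prod_mul_distrib]
      rw [pascal j, Finset.prod_range_succ (fun k => 1 - Q * Q ^ k)]
      rw [shift (fun y => 1 - y) j] at hB ⊢
      rw [shift (fun y => e - y) j]
      have hB' := right_ne_zero_of_mul hB
      generalize ∏ k ∈ Finset.range (j + 1), (Q ^ n - Q ^ k) = P₁
      field_simp
    rw [Finset.sum_range_succ', Finset.sum_congr rfl term, Finset.sum_sub_distrib,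
      ← Finset.mul_sum, ih₂]
    have vanish : ∏ k ∈ Finset.range (n + 1), (Q ^ n - Q ^ k) * (e - c * Q ^ k) = 0 :=
      Finset.prod_eq_zero (Finset.self_mem_range_succ n) (by simp)
    have split := Finset.sum_range_succ' (fun i =>
      (∏ k ∈ Finset.range i, (Q ^ n - Q ^ k) * (e - c * Q ^ k)) /
        ((∏ k ∈ Finset.range i, (1 - Q * Q ^ k)) *
          ∏ k ∈ Finset.range i, (1 - c * Q ^ k))) (n + 1)
    rw [Finset.sum_range_succ, ih₁, vanish, zero_div, add_zero] at split
    simp only [Finset.prod_range_zero] at split ⊢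
    rw [sub_add_eq_add_sub, ← split]
    simp only [Finset.prod_div_distrib]
    have hB : ∏ k ∈ Finset.range (n + 1), (1 - c * Q ^ k) ≠ 0 :=
      Finset.prod_ne_zero_iff.2 fun k hk => hc k (Finset.mem_range.1 hk)
    have hs := shift (fun y => 1 - y) n
    have hB₂ : ∏ k ∈ Finset.range n, (1 - c * Q * Q ^ k) ≠ 0 := by
      rw [hs] at hB
      exact right_ne_zero_of_mul hB
    have hlast := hc n (by omega)
    have hB₁ : ∏ k ∈ Finset.range n, (1 - c * Q ^ k) ≠ 0 := by
      rw [Finset.prod_range_succ] at hB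
      exact left_ne_zero_of_mul hB
    rw [Finset.prod_range_succ] at hs
    rw [Finset.prod_range_succ, Finset.prod_range_succ]
    have hr : (∏ k ∈ Finset.range n, (1 - e * Q ^ k)) / ∏ k ∈ Finset.range n, (1 - c * Q * Q ^ k) =
        (1 - c) * (∏ k ∈ Finset.range n, (1 - e * Q ^ k)) /
          ((∏ k ∈ Finset.range n, (1 - c * Q ^ k)) * (1 - c * Q ^ n)) := by
      rw [hs]
      field_simp
    rw [hr]
    field_simp
    ring

theorem prod_neg_odd_pow {F : Type*} [Field F] (q x : F) (i : ℕ) :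
    ∏ k ∈ Finset.range i, (-(x * q ^ (2 * k + 1))) = (-x) ^ i * q ^ (i ^ 2) := by
  induction i with
  | zero => simp
  | succ i ih => rw [Finset.prod_range_succ, ih]; ring

/-- The `q`-Racah specialization of the `q`-Chu–Vandermonde summation, with the eigenvalues written
as `x / q ^ (2 * k) + x⁻¹ * q ^ (2 * k)`. -/
theorem sum_qRacah {F : Type*} [Field F] (q x : F) (hq : q ≠ 0) (hx : x ≠ 0) (n : ℕ)
    (hQ : ∀ k < n, 1 - q ^ 2 * (q ^ 2) ^ k ≠ 0) (hc : ∀ k < n, 1 - x⁻¹ * q * (q ^ 2) ^ k ≠ 0) :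
    ∑ i ∈ Finset.range (n + 1), (-1 : F) ^ i * q ^ (i ^ 2) *
        (∏ k ∈ Finset.range i,
          (x / (q ^ 2) ^ n + x⁻¹ * (q ^ 2) ^ n - (x / (q ^ 2) ^ k + x⁻¹ * (q ^ 2) ^ k))) /
        ((∏ k ∈ Finset.range i, (1 - q ^ 2 * (q ^ 2) ^ k)) *
          ∏ k ∈ Finset.range i, (1 - x⁻¹ * q * (q ^ 2) ^ k)) =
      (-x) ^ n / q ^ (n ^ 2) := by
  have key := sum_prod_qChuVandermonde (q ^ 2) (x * q / (q ^ 2) ^ n) n (x⁻¹ * q) hQ hc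
  have hnum : ∏ k ∈ Finset.range n, (1 - x * q / (q ^ 2) ^ n * (q ^ 2) ^ k) =
      (-x) ^ n / q ^ (n ^ 2) * ∏ k ∈ Finset.range n, (1 - x⁻¹ * q * (q ^ 2) ^ k) := by
    have h := prod_neg_odd_pow q⁻¹ x n
    rw [inv_pow, ← div_eq_mul_inv] at h
    rw [← h, ← Finset.prod_mul_distrib, ← Finset.prod_range_reflect]
    refine Finset.prod_congr rfl fun k hk => ?_
    obtain ⟨m, rfl⟩ : ∃ m, n = k + 1 + m := ⟨n - (k + 1), by
      have := Finset.mem_range.1 hk; omega⟩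
    rw [show k + 1 + m - 1 - k = m by omega, inv_pow]
    field_simp
    ring
  have hB : ∏ k ∈ Finset.range n, (1 - x⁻¹ * q * (q ^ 2) ^ k) ≠ 0 :=
    Finset.prod_ne_zero_iff.2 fun k hk => hc k (Finset.mem_range.1 hk)
  rw [Finset.prod_div_distrib, hnum, mul_div_cancel_right₀ _ hB] at key
  rw [← key]
  refine Finset.sum_congr rfl fun i _ => ?_
  have h := prod_neg_odd_pow q 1 i
  rw [← h, ← Finset.prod_mul_distrib]
  congr 1
  refine Finset.prod_congr rfl fun k _ => ?_
  field_simp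
  ring

theorem stmt7
    {F : Type*} [Field F]
    (q a : F) (hq0 : q ≠ 0) (ha0 : a ≠ 0) (hq4 : q ^ 4 ≠ 1)
    (d : ℕ) (hd : 1 ≤ d)
    (hq2i : ∀ i : ℕ, 1 ≤ i → i ≤ d → q ^ (2 * i) ≠ 1)
    (ha2 : ∀ j : ℤ, 1 - (d : ℤ) ≤ j → j ≤ (d : ℤ) - 1 → a ^ 2 ≠ q ^ (2 * j))
    (θ t : ℕ → F)
    (hθ : ∀ i : ℕ, i ≤ d → θ i = a * q ^ ((d : ℤ) - 2 * (i : ℤ)) + a⁻¹ * q ^ (2 * (i : ℤ) - (d : ℤ)))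
    (ht : ∀ i : ℕ, i ≤ d → t i = (-1 : F) ^ i * a ^ i * q ^ (i * (d - i)))
    (r s : ℕ) (hrs : r ≤ s) (hsd : s ≤ d) :
    t s / t r =
      ∑ i ∈ Finset.range (s - r + 1),
        (-1 : F) ^ i * q ^ (i ^ 2) * (∏ k ∈ Finset.range i, (θ s - θ (r + k))) /
          ((∏ k ∈ Finset.range i, (1 - q ^ 2 * (q ^ 2) ^ k)) *
            (∏ k ∈ Finset.range i, (1 - a⁻¹ * q ^ (2 * (r : ℤ) + 1 - (d : ℤ)) * (q ^ 2) ^ k))) ∧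
    t r / t s =
      ∑ i ∈ Finset.range (s - r + 1),
        (-1 : F) ^ i * q ^ (-((i : ℤ) ^ 2)) * (∏ k ∈ Finset.range i, (θ s - θ (r + k))) /
          ((∏ k ∈ Finset.range i, (1 - q ^ (-2 : ℤ) * (q ^ (-2 : ℤ)) ^ k)) *
            (∏ k ∈ Finset.range i, (1 - a * q ^ ((d : ℤ) - 2 * (r : ℤ) - 1) * (q ^ (-2 : ℤ)) ^ k))) := by
  obtain ⟨n, rfl⟩ := Nat.exists_eq_add_of_le hrs
  rw [Nat.add_sub_cancel_left]
  set x : F := a * q ^ ((d : ℤ) - 2 * r) with hxdef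
  have hx : x ≠ 0 := mul_ne_zero ha0 (zpow_ne_zero _ hq0)
  have hxinv : x⁻¹ = a⁻¹ * q ^ (2 * (r : ℤ) - d) := by
    rw [hxdef, mul_inv, ← zpow_neg, neg_sub]
  have hsq : ∀ k : ℕ, (q ^ 2) ^ k = q ^ (2 * (k : ℤ)) := fun k => by
    rw [← pow_mul, ← zpow_natCast]; push_cast; rfl
  have hθx : ∀ k ≤ n, θ (r + k) = x / (q ^ 2) ^ k + x⁻¹ * (q ^ 2) ^ k := by
    intro k hk
    rw [hθ _ (by omega), hxinv, hxdef, hsq, div_eq_mul_inv, ← zpow_neg, mul_assoc, mul_assoc,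
      ← zpow_add₀ hq0, ← zpow_add₀ hq0]
    push_cast
    congr 3 <;> ring
  have hθx' : ∀ k ≤ n, θ (r + k) = x⁻¹ / (q⁻¹ ^ 2) ^ k + x⁻¹⁻¹ * (q⁻¹ ^ 2) ^ k := by
    intro k hk
    rw [hθx k hk, inv_inv, inv_pow, inv_pow, div_inv_eq_mul, div_eq_mul_inv, add_comm]
  have hc₁ : a⁻¹ * q ^ (2 * (r : ℤ) + 1 - d) = x⁻¹ * q := by
    rw [hxinv, mul_assoc, ← zpow_add_one₀ hq0]; congr 2; ring
  have hc₂ : a * q ^ ((d : ℤ) - 2 * r - 1) = x⁻¹⁻¹ * q⁻¹ := by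
    rw [inv_inv, hxdef, mul_assoc, ← zpow_sub_one₀ hq0]
  have hq2 : q ^ (-2 : ℤ) = q⁻¹ ^ 2 := by
    rw [zpow_neg, inv_pow, zpow_ofNat]
  have hQ : ∀ k < n, q ^ 2 * (q ^ 2) ^ k ≠ 1 := by
    intro k hk h
    refine hq2i (k + 1) (by omega) (by omega) ?_
    rw [← h]; ring
  have hc : ∀ k < n, x⁻¹ * q * (q ^ 2) ^ k ≠ 1 := by
    intro k hk h
    rw [← hc₁, hsq, mul_assoc, ← zpow_add₀ hq0, inv_mul_eq_one₀ ha0] at h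
    refine ha2 (2 * (r : ℤ) + 1 - d + 2 * k) (by omega) (by omega) ?_
    rw [h, ← zpow_natCast, ← zpow_mul]
    congr 1
    push_cast
    ring
  have htr : t r ≠ 0 := by
    rw [ht r (by omega)]
    exact mul_ne_zero (mul_ne_zero (pow_ne_zero _ (by simp)) (pow_ne_zero _ ha0))
      (pow_ne_zero _ hq0)
  have hts : t (r + n) = t r * ((-x) ^ n / q ^ (n ^ 2)) := by
    rw [ht _ hsd, ht r (by omega), neg_pow x, hxdef]
    obtain ⟨m, rfl⟩ := Nat.exists_eq_add_of_le hsd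
    rw [show r + n + m - (r + n) = m by omega, show r + n + m - r = n + m by omega, mul_pow,
      ← zpow_natCast (q ^ _) n, ← zpow_mul]
    have hexp : q ^ ((r + n) * m) * q ^ (n ^ 2) =
        q ^ (r * (n + m)) * q ^ ((((r + n + m : ℕ) : ℤ) - 2 * r) * n) := by
      rw [← pow_add, ← zpow_natCast, ← zpow_natCast q (r * (n + m)), ← zpow_add₀ hq0]
      congr 1
      push_cast
      ring
    rw [← mul_div_assoc, eq_div_iff (pow_ne_zero _ hq0), mul_assoc, hexp]
    ring
  have hratio : t (r + n) / t r = (-x) ^ n / q ^ (n ^ 2) := by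
    rw [hts, mul_div_cancel_left₀ _ htr]
  constructor
  · rw [hratio, ← sum_qRacah q x hq0 hx n (fun k hk => sub_ne_zero.2 (hQ k hk).symm)
      (fun k hk => sub_ne_zero.2 (hc k hk).symm), hc₁]
    refine Finset.sum_congr rfl fun i hi => ?_
    have hprod : ∏ k ∈ Finset.range i, (θ (r + n) - θ (r + k)) = ∏ k ∈ Finset.range i,
        (x / (q ^ 2) ^ n + x⁻¹ * (q ^ 2) ^ n - (x / (q ^ 2) ^ k + x⁻¹ * (q ^ 2) ^ k)) := by
      refine Finset.prod_congr rfl fun k hk => ?_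
      rw [hθx n le_rfl, hθx k (by
        have := Finset.mem_range.1 hi; have := Finset.mem_range.1 hk; omega)]
    rw [hprod]
  · have hinv : t r / t (r + n) = (-x⁻¹) ^ n / q⁻¹ ^ (n ^ 2) := by
      rw [← inv_div, hratio, inv_div, neg_pow x⁻¹, neg_pow x, inv_pow, inv_pow, div_inv_eq_mul]
      rcases neg_one_pow_eq_or F n with h | h <;> rw [h] <;> field_simp
    rw [hinv, ← sum_qRacah q⁻¹ x⁻¹ (inv_ne_zero hq0) (inv_ne_zero hx) n
      (fun k hk h => hQ k hk (by
        rw [sub_eq_zero, inv_pow, inv_pow, ← mul_inv, eq_comm, inv_eq_one] at h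
        exact h))
      (fun k hk h => hc k hk (by
        rw [sub_eq_zero, inv_pow, inv_pow, ← mul_inv, ← mul_inv, eq_comm, inv_eq_one] at h
        exact h)), hc₂, hq2]
    refine Finset.sum_congr rfl fun i hi => ?_
    have hpow : q ^ (-((i : ℤ) ^ 2)) = q⁻¹ ^ (i ^ 2) := by
      rw [zpow_neg, inv_pow, ← zpow_natCast]; push_cast; rfl
    have hprod : ∏ k ∈ Finset.range i, (θ (r + n) - θ (r + k)) = ∏ k ∈ Finset.range i,
        (x⁻¹ / (q⁻¹ ^ 2) ^ n + x⁻¹⁻¹ * (q⁻¹ ^ 2) ^ n - (x⁻¹ / (q⁻¹ ^ 2) ^ k + x⁻¹⁻¹ * (q⁻¹ ^ 2) ^ k)) := by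
      refine Finset.prod_congr rfl fun k hk => ?_
      rw [hθx' n le_rfl, hθx' k (by
        have := Finset.mem_range.1 hi; have := Finset.mem_range.1 hk; omega)]
    rw [hpow, hprod]
end

section
/- For 0 ≤ r ≤ d and every vector v ∈ E_rV + E_{r+1}V + ⋯ + E_dV, both Wv = t_r Σ_{i=0}^{d−r} (−1)^i q^{i^2} (A − θ_rI)(A − θ_{r+1}I)⋯(A − θ_{r+i−1}I) v / ((q^2; q^2)_i (a^{−1}q^{2r+1−d}; q^2)_i) and W^{-1}v = t_r^{-1} Σ_{i=0}^{d−r} (−1)^i q^{−i^2} (A − θ_rI)(A − θ_{r+1}I)⋯(A − θ_{r+i−1}I) v / ((q^{−2}; q^{−2})_i (a q^{d−2r−1}; q^{−2})_i). -/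
/-- The Gaussian binomial coefficient `[n, k]` at `Q`. -/
def gaussBinom {F : Type*} [Field F] (Q : F) : ℕ → ℕ → F
  | _, 0 => 1
  | 0, _ + 1 => 0
  | n + 1, k + 1 => Q ^ (n - k) * gaussBinom Q n k + gaussBinom Q n (k + 1)

theorem gaussBinom_zero_right {F : Type*} [Field F] (Q : F) (n : ℕ) : gaussBinom Q n 0 = 1 := by
  cases n <;> rfl

theorem gaussBinom_succ_succ {F : Type*} [Field F] (Q : F) (n k : ℕ) :
    gaussBinom Q (n + 1) (k + 1) =
      Q ^ (n - k) * gaussBinom Q n k + gaussBinom Q n (k + 1) := rfl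

theorem gaussBinom_eq_zero {F : Type*} [Field F] (Q : F) {n k : ℕ} (h : n < k) :
    gaussBinom Q n k = 0 := by
  induction n generalizing k with
  | zero => obtain ⟨k, rfl⟩ := Nat.exists_eq_succ_of_ne_zero h.ne'; rfl
  | succ n ih =>
    obtain ⟨k, rfl⟩ := Nat.exists_eq_succ_of_ne_zero (Nat.ne_zero_of_lt h)
    rw [Nat.succ_eq_add_one, gaussBinom_succ_succ, ih (by omega), ih (by omega)]
    simp

theorem gaussBinom_mul_prod {F : Type*} [Field F] (Q : F) (n i : ℕ) :
    gaussBinom Q n i * ∏ k ∈ Finset.range i, (1 - Q * Q ^ k) =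
      ∏ k ∈ Finset.range i, (1 - Q ^ (n - k)) := by
  induction n generalizing i with
  | zero =>
    cases i with
    | zero => simp [gaussBinom_zero_right]
    | succ i => simp [gaussBinom_eq_zero Q (Nat.succ_pos i), Finset.prod_range_succ]
  | succ n ih =>
    cases i with
    | zero => simp [gaussBinom_zero_right]
    | succ i =>
      rcases le_or_gt i n with h | h
      · have h1 := ih i
        have h2 := ih (i + 1)
        rw [Finset.prod_range_succ' (fun k => 1 - Q ^ (n + 1 - k))]
        simp only [Nat.add_sub_add_right, Nat.sub_zero]
        rw [Finset.prod_range_succ, Finset.prod_range_succ] at h2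
        rw [gaussBinom_succ_succ, Finset.prod_range_succ]
        have h3 : Q ^ (n + 1) = Q ^ (n - i) * Q ^ i * Q := by
          rw [← pow_add, Nat.sub_add_cancel h, pow_succ]
        rw [h3]
        linear_combination Q ^ (n - i) * (1 - Q * Q ^ i) * h1 + h2
      · rw [gaussBinom_eq_zero Q (by omega), zero_mul, eq_comm]
        exact Finset.prod_eq_zero (Finset.mem_range.2 (show n + 1 < i + 1 by omega)) (by simp)

/-- The `q`-Chu–Vandermonde summation. -/
theorem sum_gaussBinom_mul_prod_div {F : Type*} [Field F] (Q x : F) (n : ℕ) (β : F)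
    (h : ∀ k < n, 1 - x * β * Q ^ k ≠ 0) :
    ∑ i ∈ Finset.range (n + 1), (-1) ^ i * Q ^ (i.choose 2) * gaussBinom Q n i * x ^ i *
        ((∏ k ∈ Finset.range i, (1 - β * Q ^ k)) / ∏ k ∈ Finset.range i, (1 - x * β * Q ^ k)) =
      (∏ k ∈ Finset.range n, (1 - x * Q ^ k)) / ∏ k ∈ Finset.range n, (1 - x * β * Q ^ k) := by
  induction n generalizing β with
  | zero => simp [gaussBinom_zero_right]
  | succ n ih =>
    have ih1 := ih β fun k hk => h k (by omega)
    have ih2 := ih (β * Q) fun k hk => by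
      have := h (k + 1) (by omega)
      rwa [pow_succ', ← mul_assoc, mul_assoc x β Q] at this
    have hγ : 1 - x * β ≠ 0 := by simpa using h 0 (by omega)
    have hn := h n (by omega)
    have hP : ∏ k ∈ Finset.range n, (1 - x * β * Q ^ k) ≠ 0 :=
      Finset.prod_ne_zero_iff.2 fun k hk => h k (by have := Finset.mem_range.1 hk; omega)
    have shift (c : F) (i : ℕ) : ∏ k ∈ Finset.range (i + 1), (1 - c * Q ^ k) =
        (1 - c) * ∏ k ∈ Finset.range i, (1 - c * Q * Q ^ k) := by
      rw [Finset.prod_range_succ', mul_comm]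
      simp [pow_succ', mul_assoc]
    have key : ∀ i ∈ Finset.range (n + 1),
        (-1) ^ (i + 1) * Q ^ ((i + 1).choose 2) * gaussBinom Q (n + 1) (i + 1) * x ^ (i + 1) *
          ((∏ k ∈ Finset.range (i + 1), (1 - β * Q ^ k)) /
            ∏ k ∈ Finset.range (i + 1), (1 - x * β * Q ^ k)) =
        -(Q ^ n * x * ((1 - β) / (1 - x * β))) *
          ((-1) ^ i * Q ^ (i.choose 2) * gaussBinom Q n i * x ^ i *
          ((∏ k ∈ Finset.range i, (1 - β * Q * Q ^ k)) /
            ∏ k ∈ Finset.range i, (1 - x * (β * Q) * Q ^ k))) +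
        (-1) ^ (i + 1) * Q ^ ((i + 1).choose 2) * gaussBinom Q n (i + 1) * x ^ (i + 1) *
          ((∏ k ∈ Finset.range (i + 1), (1 - β * Q ^ k)) /
            ∏ k ∈ Finset.range (i + 1), (1 - x * β * Q ^ k)) := by
      intro i hi
      have hi : i ≤ n := by have := Finset.mem_range.1 hi; omega
      rw [gaussBinom_succ_succ, shift, shift, ← mul_assoc x β Q, mul_div_mul_comm]
      have : Q ^ n = Q ^ i * Q ^ (n - i) := by rw [← pow_add, Nat.add_sub_cancel' hi]
      rw [this, Nat.choose_succ_succ' i 1, Nat.choose_one_right, pow_add]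
      ring
    rw [Finset.sum_range_succ', Finset.sum_congr rfl key, Finset.sum_add_distrib,
      ← Finset.mul_sum, ih2, add_assoc]
    have h0 : gaussBinom Q (n + 1) 0 = gaussBinom Q n 0 := by simp [gaussBinom_zero_right]
    rw [h0, ← Finset.sum_range_succ' (fun i => (-1) ^ i * Q ^ (i.choose 2) * gaussBinom Q n i *
      x ^ i * ((∏ k ∈ Finset.range i, (1 - β * Q ^ k)) /
        ∏ k ∈ Finset.range i, (1 - x * β * Q ^ k))), Finset.sum_range_succ,
      gaussBinom_eq_zero Q (Nat.lt_succ_self n), ih1, ← mul_assoc x β Q]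
    have hs := shift (x * β) n
    rw [Finset.prod_range_succ] at hs
    rw [Finset.prod_range_succ (fun k => 1 - x * Q ^ k),
      Finset.prod_range_succ (fun k => 1 - x * β * Q ^ k)]
    simp only [mul_zero, zero_mul, add_zero]
    have hs' : ∏ k ∈ Finset.range n, (1 - x * β * Q * Q ^ k) =
        (∏ k ∈ Finset.range n, (1 - x * β * Q ^ k)) * (1 - x * β * Q ^ n) / (1 - x * β) := by
      rw [hs, mul_div_cancel_left₀ _ hγ]
    rw [hs']
    generalize Q ^ n = y at hn ⊢
    generalize hD : 1 - x * β * y = D at hn ⊢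
    field_simp
    rw [← hD]
    ring

theorem sum_newton_eq_pow {F : Type*} [Field F] (p b : F) (hp : p ≠ 0) (hb : b ≠ 0) (n : ℕ)
    (hQ : ∀ i, 1 ≤ i → i ≤ n → p ^ (2 * i) ≠ 1)
    (hγ : ∀ k < n, 1 - b⁻¹ * p * (p ^ 2) ^ k ≠ 0) :
    ∑ i ∈ Finset.range (n + 1), (-1) ^ i * p ^ (i ^ 2) /
        ((∏ k ∈ Finset.range i, (1 - p ^ 2 * (p ^ 2) ^ k)) *
          ∏ k ∈ Finset.range i, (1 - b⁻¹ * p * (p ^ 2) ^ k)) *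
        ∏ k ∈ Finset.range i, (b * ((p ^ 2) ^ n)⁻¹ + b⁻¹ * (p ^ 2) ^ n -
          (b * ((p ^ 2) ^ k)⁻¹ + b⁻¹ * (p ^ 2) ^ k)) =
      (-1) ^ n * b ^ n * (p ^ (n ^ 2))⁻¹ := by
  have hx : b * p * ((p ^ 2) ^ n)⁻¹ * (b⁻¹ ^ 2 * (p ^ 2) ^ n) = b⁻¹ * p := by
    field_simp
  have hV := sum_gaussBinom_mul_prod_div (p ^ 2) (b * p * ((p ^ 2) ^ n)⁻¹) n
    (b⁻¹ ^ 2 * (p ^ 2) ^ n) (by rwa [hx])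
  rw [hx] at hV
  have hprod : ∏ k ∈ Finset.range n, (1 - b * p * ((p ^ 2) ^ n)⁻¹ * (p ^ 2) ^ k) =
      (-1) ^ n * b ^ n * (p ^ (n ^ 2))⁻¹ *
        ∏ k ∈ Finset.range n, (1 - b⁻¹ * p * (p ^ 2) ^ k) := by
    rw [← Finset.prod_range_reflect]
    have : ∀ m, ∏ k ∈ Finset.range m, -(b * (p * (p ^ 2) ^ k)⁻¹) =
        (-1) ^ m * b ^ m * (p ^ (m ^ 2))⁻¹ := by
      intro m
      induction m with
      | zero => simp
      | succ m ih =>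
        rw [Finset.prod_range_succ, ih, show (m + 1) ^ 2 = m ^ 2 + (1 + 2 * m) by ring,
          pow_add p, pow_add p, pow_mul p]
        field_simp
        ring
    rw [← this, ← Finset.prod_mul_distrib]
    refine Finset.prod_congr rfl fun k hk => ?_
    have hk := Finset.mem_range.1 hk
    have : (p ^ 2) ^ n = (p ^ 2) ^ (n - 1 - k) * ((p ^ 2) ^ k * p ^ 2) := by
      rw [← pow_succ, ← pow_add]
      congr 1
      omega
    rw [this]
    field_simp
    ring
  have hne : ∏ k ∈ Finset.range n, (1 - b⁻¹ * p * (p ^ 2) ^ k) ≠ 0 :=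
    Finset.prod_ne_zero_iff.2 fun k hk => hγ k (Finset.mem_range.1 hk)
  rw [hprod, mul_div_cancel_right₀ _ hne] at hV
  rw [← hV]
  refine Finset.sum_congr rfl fun i hi => ?_
  have hi : i ≤ n := by have := Finset.mem_range.1 hi; omega
  have hfac : ∏ k ∈ Finset.range i, (b * ((p ^ 2) ^ n)⁻¹ + b⁻¹ * (p ^ 2) ^ n -
      (b * ((p ^ 2) ^ k)⁻¹ + b⁻¹ * (p ^ 2) ^ k)) =
      (b * ((p ^ 2) ^ n)⁻¹) ^ i * (∏ k ∈ Finset.range i, (1 - (p ^ 2) ^ (n - k))) *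
        ∏ k ∈ Finset.range i, (1 - b⁻¹ ^ 2 * (p ^ 2) ^ n * (p ^ 2) ^ k) := by
    rw [← Finset.card_range i, ← Finset.prod_const, Finset.card_range,
      ← Finset.prod_mul_distrib, ← Finset.prod_mul_distrib]
    refine Finset.prod_congr rfl fun k hk => ?_
    have hk := Finset.mem_range.1 hk
    have : (p ^ 2) ^ n = (p ^ 2) ^ (n - k) * (p ^ 2) ^ k := by
      rw [← pow_add, Nat.sub_add_cancel (by omega)]
    rw [this]
    field_simp
    ring
  have hQi : ∏ k ∈ Finset.range i, (1 - p ^ 2 * (p ^ 2) ^ k) ≠ 0 :=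
    Finset.prod_ne_zero_iff.2 fun k hk => by
      have hk := Finset.mem_range.1 hk
      rw [← pow_succ', ← pow_mul, sub_ne_zero]
      exact (hQ (k + 1) (by omega) (by omega)).symm
  have hpow : p ^ (i ^ 2) = (p ^ 2) ^ (i.choose 2) * p ^ i := by
    rw [← pow_mul, ← pow_add]
    have := Nat.choose_two_right i
    have := Nat.div_mul_cancel (Nat.even_mul_pred_self i).two_dvd
    cases i with
    | zero => rfl
    | succ i =>
      congr 1
      simp only [Nat.add_sub_cancel] at *
      nlinarith
  rw [hfac, ← gaussBinom_mul_prod, hpow, mul_right_comm b p, mul_pow _ p]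
  have hγi : ∏ k ∈ Finset.range i, (1 - b⁻¹ * p * (p ^ 2) ^ k) ≠ 0 :=
    Finset.prod_ne_zero_iff.2 fun k hk => hγ k (by have := Finset.mem_range.1 hk; omega)
  generalize (b * ((p ^ 2) ^ n)⁻¹) ^ i = X
  field_simp

theorem sum_smul_apply_eq_newton {F : Type*} [Field F] {V : Type*} [AddCommGroup V] [Module F V]
    (d : ℕ) (θ : ℕ → F) (A : Module.End F V) (E : ℕ → Module.End F V)
    (hEE : ∀ i j : ℕ, i ≤ d → j ≤ d → E i * E j = if i = j then E i else 0)
    (hAE : A = ∑ i ∈ Finset.range (d + 1), θ i • E i)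
    (r : ℕ) (u c : ℕ → F) (τ : F)
    (hu : ∀ n, r + n ≤ d → u (r + n) = τ * ∑ i ∈ Finset.range (n + 1),
      c i * ∏ k ∈ Finset.range i, (θ (r + n) - θ (r + k)))
    (v : V) (hv : v ∈ ⨆ i ∈ Finset.Icc r d, LinearMap.range (E i)) :
    (∑ i ∈ Finset.range (d + 1), u i • E i) v = τ • ∑ i ∈ Finset.range (d - r + 1),
      c i • (((List.range i).map (fun k => A - θ (r + k) • (1 : Module.End F V))).prod v) := by
  have hle : ⨆ i ∈ Finset.Icc r d, LinearMap.range (E i) ≤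
      LinearMap.eqLocus (∑ i ∈ Finset.range (d + 1), u i • E i)
        (τ • ∑ i ∈ Finset.range (d - r + 1),
          c i • ((List.range i).map (fun k => A - θ (r + k) • (1 : Module.End F V))).prod) := by
    refine iSup₂_le fun s hs => ?_
    rintro _ ⟨w, rfl⟩
    obtain ⟨hrs, hsd⟩ := Finset.mem_Icc.1 hs
    obtain ⟨n, rfl⟩ := Nat.exists_eq_add_of_le hrs
    have hdiag (f : ℕ → F) : (∑ i ∈ Finset.range (d + 1), f i • E i) (E (r + n) w) =
        f (r + n) • E (r + n) w := by
      rw [LinearMap.sum_apply, Finset.sum_eq_single (r + n)]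
      · rw [LinearMap.smul_apply, ← Module.End.mul_apply, hEE _ _ hsd hsd, if_pos rfl]
      · intro i hi hne
        rw [LinearMap.smul_apply, ← Module.End.mul_apply,
          hEE _ _ (by have := Finset.mem_range.1 hi; omega) hsd, if_neg hne]
        simp
      · intro h
        exact absurd (Finset.mem_range.2 (by omega)) h
    have hprod (i : ℕ) :
        ((List.range i).map (fun k => A - θ (r + k) • (1 : Module.End F V))).prod (E (r + n) w) =
          (∏ k ∈ Finset.range i, (θ (r + n) - θ (r + k))) • E (r + n) w := by
      induction i with
      | zero => simp
      | succ i ih =>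
        rw [List.range_succ, List.map_append, List.prod_append, Module.End.mul_apply]
        simp only [List.map_cons, List.map_nil, List.prod_singleton]
        rw [LinearMap.sub_apply, hAE, hdiag, ← hAE, LinearMap.smul_apply, Module.End.one_apply,
          ← sub_smul, map_smul, ih, smul_smul, Finset.prod_range_succ, mul_comm]
    rw [LinearMap.mem_eqLocus, hdiag, hu n hsd, LinearMap.smul_apply, LinearMap.sum_apply,
      mul_smul, Finset.sum_smul]
    congr 1
    simp only [LinearMap.smul_apply, hprod, smul_smul]
    refine Finset.sum_subset (Finset.range_subset_range.2 (by omega)) fun i _ hi => ?_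
    have hi : n < i := by
      by_contra hlt
      exact hi (Finset.mem_range.2 (by omega))
    rw [Finset.prod_eq_zero (Finset.mem_range.2 hi) (sub_self _), mul_zero, zero_smul]
  simpa using hle hv

theorem stmt8
    {F : Type*} [Field F] {V : Type*} [AddCommGroup V] [Module F V]
    [FiniteDimensional F V] [Nontrivial V]
    (q a : F) (hq0 : q ≠ 0) (ha0 : a ≠ 0) (hq4 : q ^ 4 ≠ 1)
    (d : ℕ) (hd : 1 ≤ d)
    (hq2i : ∀ i : ℕ, 1 ≤ i → i ≤ d → q ^ (2 * i) ≠ 1)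
    (ha2 : ∀ j : ℤ, 1 - (d : ℤ) ≤ j → j ≤ (d : ℤ) - 1 → a ^ 2 ≠ q ^ (2 * j))
    (θ : ℕ → F)
    (hθ : ∀ i : ℕ, i ≤ d → θ i = a * q ^ ((d : ℤ) - 2 * (i : ℤ)) + a⁻¹ * q ^ (2 * (i : ℤ) - (d : ℤ)))
    (hθdist : ∀ i j : ℕ, i ≤ d → j ≤ d → i ≠ j → θ i ≠ θ j)
    (A : Module.End F V) (E : ℕ → Module.End F V)
    (hEE : ∀ i j : ℕ, i ≤ d → j ≤ d → E i * E j = if i = j then E i else 0)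
    (hEsum : ∑ i ∈ Finset.range (d + 1), E i = 1)
    (hAE : A = ∑ i ∈ Finset.range (d + 1), θ i • E i)
    (hEne : ∀ i : ℕ, i ≤ d → E i ≠ 0)
    (t : ℕ → F)
    (ht : ∀ i : ℕ, i ≤ d → t i = (-1 : F) ^ i * a ^ i * q ^ (i * (d - i)))
    (W Winv : Module.End F V)
    (hW : W = ∑ i ∈ Finset.range (d + 1), t i • E i)
    (hWinv : Winv = ∑ i ∈ Finset.range (d + 1), (t i)⁻¹ • E i)
    (r : ℕ) (hr : r ≤ d)
    (v : V) (hv : v ∈ ⨆ i ∈ Finset.Icc r d, LinearMap.range (E i)) :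
    W v = t r • ∑ i ∈ Finset.range (d - r + 1),
        ((-1 : F) ^ i * q ^ (i ^ 2) /
          ((∏ k ∈ Finset.range i, (1 - q ^ 2 * (q ^ 2) ^ k)) *
            (∏ k ∈ Finset.range i, (1 - a⁻¹ * q ^ (2 * (r : ℤ) + 1 - (d : ℤ)) * (q ^ 2) ^ k)))) •
          (((List.range i).map (fun k => A - θ (r + k) • (1 : Module.End F V))).prod v) ∧
    Winv v = (t r)⁻¹ • ∑ i ∈ Finset.range (d - r + 1),
        ((-1 : F) ^ i * q ^ (-((i : ℤ) ^ 2)) /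
          ((∏ k ∈ Finset.range i, (1 - q ^ (-2 : ℤ) * (q ^ (-2 : ℤ)) ^ k)) *
            (∏ k ∈ Finset.range i, (1 - a * q ^ ((d : ℤ) - 2 * (r : ℤ) - 1) * (q ^ (-2 : ℤ)) ^ k)))) •
          (((List.range i).map (fun k => A - θ (r + k) • (1 : Module.End F V))).prod v) := by
  have hb : a * q ^ ((d : ℤ) - 2 * r) ≠ 0 := mul_ne_zero ha0 (zpow_ne_zero _ hq0)
  have hpow2 (k : ℕ) : (q ^ 2) ^ k = q ^ (2 * (k : ℤ)) := by
    rw [← pow_mul, ← zpow_natCast]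
    push_cast
    rfl
  have hγ (k : ℕ) (hk : r + k + 1 ≤ d) :
      a * q ^ ((d : ℤ) - 2 * r) ≠ q * (q ^ 2) ^ k := by
    intro h
    have h1 : a = q ^ (2 * (r : ℤ) + 2 * k + 1 - d) := by
      rw [hpow2, ← zpow_one_add₀ hq0, ← eq_mul_inv_iff_mul_eq₀ (zpow_ne_zero _ hq0), ← zpow_neg,
        ← zpow_add₀ hq0] at h
      rw [h]
      congr 1
      ring
    refine ha2 (2 * (r : ℤ) + 2 * k + 1 - d) (by omega) (by omega) ?_
    rw [h1, ← zpow_natCast, ← zpow_mul]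
    congr 1
    push_cast
    ring
  have hθ' (k : ℕ) (hk : r + k ≤ d) : θ (r + k) =
      a * q ^ ((d : ℤ) - 2 * r) * ((q ^ 2) ^ k)⁻¹ +
        (a * q ^ ((d : ℤ) - 2 * r))⁻¹ * (q ^ 2) ^ k := by
    rw [hθ _ hk, hpow2, mul_inv, ← zpow_neg, ← zpow_neg, mul_assoc, mul_assoc,
      ← zpow_add₀ hq0, ← zpow_add₀ hq0]
    congr 3 <;> push_cast <;> ring
  have ht' (n : ℕ) (hn : r + n ≤ d) : t (r + n) =
      t r * ((-1) ^ n * (a * q ^ ((d : ℤ) - 2 * r)) ^ n * (q ^ (n ^ 2))⁻¹) := by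
    rw [ht _ hn, ht _ hr, mul_pow a, ← zpow_natCast q, ← zpow_natCast q, ← zpow_natCast q,
      ← zpow_natCast (q ^ ((d : ℤ) - 2 * r)), ← zpow_mul, ← zpow_neg, pow_add, pow_add]
    have : (((r + n) * (d - (r + n)) : ℕ) : ℤ) =
        ((r * (d - r) : ℕ) : ℤ) + ((d : ℤ) - 2 * r) * n + -((n ^ 2 : ℕ) : ℤ) := by
      push_cast [hn, hr]
      ring
    rw [this, zpow_add₀ hq0, zpow_add₀ hq0]
    ring
  subst hW hWinv
  refine ⟨sum_smul_apply_eq_newton d θ A E hEE hAE r t _ _ (fun n hn => ?_) v hv,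
    sum_smul_apply_eq_newton d θ A E hEE hAE r (fun i => (t i)⁻¹) _ _ (fun n hn => ?_) v hv⟩
  · rw [ht' n hn, ← sum_newton_eq_pow q _ hq0 hb n (fun i h1 h2 => hq2i i h1 (by omega))
      (fun k hk => ?_)]
    · congr 1
      refine Finset.sum_congr rfl fun i hi => ?_
      have hi := Finset.mem_range.1 hi
      congr 1
      · congr 2
        refine Finset.prod_congr rfl fun k _ => ?_
        rw [mul_inv, ← zpow_neg, mul_assoc a⁻¹, ← zpow_add_one₀ hq0]
        congr 4
        ring
      · refine Finset.prod_congr rfl fun k hk => ?_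
        have hk := Finset.mem_range.1 hk
        rw [hθ' n hn, hθ' k (by omega)]
    · have := hγ k (by omega)
      rw [mul_assoc, sub_ne_zero]
      intro h
      rw [eq_inv_mul_iff_mul_eq₀ hb, mul_one] at h
      exact this h
  · have hq2 : q ^ (-2 : ℤ) = q⁻¹ ^ 2 := by
      rw [zpow_neg, inv_pow]
      norm_cast
    have key := sum_newton_eq_pow q⁻¹ (a * q ^ ((d : ℤ) - 2 * r))⁻¹ (inv_ne_zero hq0)
      (inv_ne_zero hb) n (fun i h1 h2 => by
        rw [inv_pow, Ne, inv_eq_one]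
        exact hq2i i h1 (by omega)) (fun k hk => ?_)
    · have hinv : (t (r + n))⁻¹ = (t r)⁻¹ *
          ((-1) ^ n * (a * q ^ ((d : ℤ) - 2 * r))⁻¹ ^ n * (q⁻¹ ^ (n ^ 2))⁻¹) := by
        rw [ht' n hn]
        have hsign : ((-1 : F) ^ n)⁻¹ = (-1) ^ n := by rw [← inv_pow, inv_neg_one]
        rw [mul_inv, mul_inv, mul_inv, hsign, inv_pow, inv_pow]
      rw [hinv, ← key]
      congr 1
      refine Finset.sum_congr rfl fun i hi => ?_
      have hi := Finset.mem_range.1 hi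
      rw [hq2]
      congr 1
      · congr 1
        · congr 1
          rw [zpow_neg, inv_pow, ← zpow_natCast q (i ^ 2)]
          push_cast
          rfl
        · congr 1
          refine Finset.prod_congr rfl fun k _ => ?_
          rw [inv_inv, mul_assoc a, ← zpow_sub_one₀ hq0]
      · refine Finset.prod_congr rfl fun k hk => ?_
        have hk := Finset.mem_range.1 hk
        rw [hθ' n hn, hθ' k (by omega)]
        simp only [inv_pow, inv_inv]
        ring
    · have := hγ k (by omega)
      rw [inv_inv, inv_pow, inv_pow, mul_assoc, ← mul_inv, sub_ne_zero]
      intro h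
      rw [eq_mul_inv_iff_mul_eq₀ (mul_ne_zero hq0 (pow_ne_zero _ (pow_ne_zero _ hq0))),
        one_mul] at h
      exact this h.symm
end

section
/- For all integers r, s with 0 ≤ r ≤ s ≤ d, the following two identities hold in F: t_r/t_s = Σ_{i=0}^{s−r} (−1)^i q^{i^2} (θ_r − θ_s)(θ_r − θ_{s−1})⋯(θ_r − θ_{s−i+1}) / ((q^2; q^2)_i (a q^{d−2s+1}; q^2)_i), and t_s/t_r = Σ_{i=0}^{s−r} (−1)^i q^{−i^2} (θ_r − θ_s)(θ_r − θ_{s−1})⋯(θ_r − θ_{s−i+1}) / ((q^{−2}; q^{−2})_i (a^{−1} q^{2s−d−1}; q^{−2})_i). (All denominators are nonzero under the stated assumptions.) -/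
open Finset in
/-- The `q`-Pascal recurrence for `∏ k < i, (p ^ n - p ^ k) / (1 - p ^ (k + 1))`, which is the
Gaussian binomial coefficient `[n, i]` times `(-1) ^ i * p ^ (i choose 2)`. -/
theorem prod_pow_sub_pow_div_succ {F : Type*} [Field F] (p : F) (n i : ℕ)
    (hp : p ^ (i + 1) ≠ 1) :
    ∏ k ∈ range (i + 1), (p ^ (n + 1) - p ^ k) / (1 - p ^ (k + 1)) =
      ∏ k ∈ range (i + 1), (p ^ n - p ^ k) / (1 - p ^ (k + 1)) -
        p ^ n * ∏ k ∈ range i, (p ^ n - p ^ k) / (1 - p ^ (k + 1)) := by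
  have hnum : ∏ k ∈ range (i + 1), (p ^ (n + 1) - p ^ k) =
      (p ^ (n + 1) - 1) * p ^ i * ∏ k ∈ range i, (p ^ n - p ^ k) := by
    rw [prod_range_succ', pow_zero]
    have : ∀ k ∈ range i, p ^ (n + 1) - p ^ (k + 1) = p * (p ^ n - p ^ k) := fun k _ => by ring
    rw [prod_congr rfl this, prod_mul_distrib, prod_const, card_range]
    ring
  have hi : 1 - p ^ (i + 1) ≠ 0 := sub_ne_zero.mpr hp.symm
  rw [prod_div_distrib, hnum, prod_range_succ _ i, prod_range_succ _ i, prod_div_distrib]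
  by_cases hD : ∏ k ∈ range i, (1 - p ^ (k + 1)) = 0
  · simp [hD]
  · field_simp
    ring

open Finset in
/-- The `q`-Chu–Vandermonde summation, with base `p`. -/
theorem sum_qChuVandermonde {F : Type*} [Field F] (p m : F) (n : ℕ)
    (hp : ∀ i, 1 ≤ i → i ≤ n → p ^ i ≠ 1) (b : F)
    (hb : ∀ k < n, 1 - m * b * p ^ k ≠ 0) :
    ∑ i ∈ range (n + 1), (∏ k ∈ range i, (p ^ n - p ^ k) / (1 - p ^ (k + 1))) * m ^ i *
        ∏ k ∈ range i, (1 - b * p ^ k) / (1 - m * b * p ^ k) =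
      ∏ k ∈ range n, (1 - m * p ^ k) / (1 - m * b * p ^ k) := by
  induction n generalizing b with
  | zero => simp
  | succ n ih =>
    have h0 : 1 - m * b ≠ 0 := by simpa using hb 0 n.succ_pos
    have hn : 1 - m * b * p ^ n ≠ 0 := hb n n.lt_succ_self
    have hp' : ∀ i, 1 ≤ i → i ≤ n → p ^ i ≠ 1 := fun i h1 h2 => hp i h1 (by omega)
    have ih₁ := ih hp' b fun k hk => hb k (by omega)
    have ih₂ := ih hp' (b * p) fun k hk => by
      have := hb (k + 1) (by omega)
      rwa [pow_succ', ← mul_assoc, mul_assoc m] at this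
    have hterm : ∀ i ∈ range (n + 1),
        (∏ k ∈ range (i + 1), (p ^ (n + 1) - p ^ k) / (1 - p ^ (k + 1))) * m ^ (i + 1) *
          ∏ k ∈ range (i + 1), (1 - b * p ^ k) / (1 - m * b * p ^ k) =
        (∏ k ∈ range (i + 1), (p ^ n - p ^ k) / (1 - p ^ (k + 1))) * m ^ (i + 1) *
          ∏ k ∈ range (i + 1), (1 - b * p ^ k) / (1 - m * b * p ^ k) -
        p ^ n * m * ((1 - b) / (1 - m * b)) *
          ((∏ k ∈ range i, (p ^ n - p ^ k) / (1 - p ^ (k + 1))) * m ^ i *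
            ∏ k ∈ range i, (1 - b * p * p ^ k) / (1 - m * (b * p) * p ^ k)) := by
      intro i hi
      rw [prod_pow_sub_pow_div_succ p n i
        (hp (i + 1) (by omega) (by have := mem_range.mp hi; omega))]
      have hshift : ∏ k ∈ range (i + 1), (1 - b * p ^ k) / (1 - m * b * p ^ k) =
          (∏ k ∈ range i, (1 - b * p * p ^ k) / (1 - m * (b * p) * p ^ k)) *
            ((1 - b) / (1 - m * b)) := by
        rw [prod_range_succ', pow_zero, mul_one, mul_one]
        congr 1
        refine prod_congr rfl fun k _ => ?_
        ring_nf
      rw [hshift]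
      ring
    have htop : ∏ k ∈ range (n + 1), (p ^ n - p ^ k) / (1 - p ^ (k + 1)) = 0 :=
      prod_eq_zero (self_mem_range_succ n) (by simp)
    have hext : ∑ i ∈ range (n + 1 + 1),
        (∏ k ∈ range i, (p ^ n - p ^ k) / (1 - p ^ (k + 1))) * m ^ i *
          ∏ k ∈ range i, (1 - b * p ^ k) / (1 - m * b * p ^ k) =
        ∏ k ∈ range n, (1 - m * p ^ k) / (1 - m * b * p ^ k) := by
      rw [sum_range_succ, htop, ih₁]
      simp
    have hratio : (1 - b) / (1 - m * b) *
        ∏ k ∈ range n, (1 - m * p ^ k) / (1 - m * (b * p) * p ^ k) =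
        (∏ k ∈ range n, (1 - m * p ^ k) / (1 - m * b * p ^ k)) *
          ((1 - b) / (1 - m * b * p ^ n)) := by
      have hden : (1 - m * b) * ∏ k ∈ range n, (1 - m * (b * p) * p ^ k) =
          (∏ k ∈ range n, (1 - m * b * p ^ k)) * (1 - m * b * p ^ n) := by
        rw [← prod_range_succ, prod_range_succ', pow_zero, mul_one, mul_comm]
        congr 1
        refine prod_congr rfl fun k _ => ?_
        ring
      rw [prod_div_distrib, prod_div_distrib, div_mul_div_comm, div_mul_div_comm, hden,
        mul_comm (1 - b)]
    rw [sum_range_succ'] at hext ⊢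
    rw [sum_congr rfl hterm, sum_sub_distrib, ← mul_sum, ih₂, prod_range_succ, mul_assoc (p ^ n * m),
      hratio]
    simp only [range_zero, prod_empty, pow_zero, mul_one] at hext ⊢
    rw [sub_add_eq_add_sub, hext]
    field_simp
    ring

open Finset in
/-- The terminating sum over `x * q ^ (2 * k) + (x * q ^ (2 * k))⁻¹`, evaluated in closed form. -/
theorem sum_prod_add_inv_sub_add_inv {F : Type*} [Field F] (q x : F) (hq : q ≠ 0) (hx : x ≠ 0)
    (n : ℕ) (hqn : ∀ i, 1 ≤ i → i ≤ n → q ^ (2 * i) ≠ 1)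
    (hxq : ∀ k < n, 1 - x * q * (q ^ 2) ^ k ≠ 0) :
    ∑ i ∈ range (n + 1), (-1 : F) ^ i * q ^ (i ^ 2) *
        (∏ k ∈ range i, (x * (q ^ 2) ^ n + (x * (q ^ 2) ^ n)⁻¹ -
          (x * (q ^ 2) ^ k + (x * (q ^ 2) ^ k)⁻¹))) /
        ((∏ k ∈ range i, (1 - q ^ 2 * (q ^ 2) ^ k)) * ∏ k ∈ range i, (1 - x * q * (q ^ 2) ^ k)) =
      (-1) ^ n * (x ^ n)⁻¹ * (q ^ (n ^ 2))⁻¹ := by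
  set m : F := q * x⁻¹ * ((q ^ 2) ^ n)⁻¹ with hm
  set b : F := x ^ 2 * (q ^ 2) ^ n with hb
  have hmb : m * b = x * q := by
    rw [hm, hb]
    field_simp
  have key := sum_qChuVandermonde (q ^ 2) m n
    (fun i h1 h2 => by rw [← pow_mul]; exact hqn i h1 h2) b (by rwa [hmb])
  rw [hmb] at key
  have hterm : ∀ i : ℕ, (-1 : F) ^ i * q ^ (i ^ 2) *
      ∏ k ∈ range i, (x * (q ^ 2) ^ n + (x * (q ^ 2) ^ n)⁻¹ -
          (x * (q ^ 2) ^ k + (x * (q ^ 2) ^ k)⁻¹)) =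
      (∏ k ∈ range i, ((q ^ 2) ^ n - (q ^ 2) ^ k)) * m ^ i *
        ∏ k ∈ range i, (1 - b * (q ^ 2) ^ k) := by
    intro i
    induction i with
    | zero => simp
    | succ i ih =>
      have hstep : -q ^ (2 * i + 1) * (x * (q ^ 2) ^ n + (x * (q ^ 2) ^ n)⁻¹ -
          (x * (q ^ 2) ^ i + (x * (q ^ 2) ^ i)⁻¹)) =
          ((q ^ 2) ^ n - (q ^ 2) ^ i) * m * (1 - b * (q ^ 2) ^ i) := by
        rw [hm, hb, pow_succ, pow_mul]
        field_simp
        ring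
      rw [prod_range_succ, prod_range_succ, prod_range_succ]
      linear_combination (((q ^ 2) ^ n - (q ^ 2) ^ i) * m * (1 - b * (q ^ 2) ^ i)) * ih +
        ((-1 : F) ^ i * q ^ (i ^ 2) * ∏ k ∈ range i, (x * (q ^ 2) ^ n + (x * (q ^ 2) ^ n)⁻¹ -
          (x * (q ^ 2) ^ k + (x * (q ^ 2) ^ k)⁻¹))) * hstep
  have hclosed : ∏ k ∈ range n, (1 - m * (q ^ 2) ^ k) =
      (-1) ^ n * (x ^ n)⁻¹ * (q ^ (n ^ 2))⁻¹ * ∏ k ∈ range n, (1 - x * q * (q ^ 2) ^ k) := by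
    have hfac : ∀ k ∈ range n, 1 - m * (q ^ 2) ^ (n - 1 - k) =
        (-x⁻¹ * (q * (q ^ 2) ^ k)⁻¹) * (1 - x * q * (q ^ 2) ^ k) := by
      intro k hk
      obtain ⟨j, rfl⟩ : ∃ j, n = k + 1 + j := ⟨n - 1 - k, by have := mem_range.mp hk; omega⟩
      rw [show k + 1 + j - 1 - k = j by omega, hm, pow_add, pow_succ]
      field_simp
      ring
    have hodd : ∀ N : ℕ, ∏ k ∈ range N, (-x⁻¹ * (q * (q ^ 2) ^ k)⁻¹) =
        (-1) ^ N * (x ^ N)⁻¹ * (q ^ (N ^ 2))⁻¹ := by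
      intro N
      induction N with
      | zero => simp
      | succ N ih =>
        rw [prod_range_succ, ih, show (N + 1) ^ 2 = N ^ 2 + (2 * N + 1) by ring, pow_add q,
          pow_succ q (2 * N), pow_mul]
        field_simp
        ring
    rw [← prod_range_reflect, prod_congr rfl hfac, prod_mul_distrib, hodd]
  have hne : ∏ k ∈ range n, (1 - x * q * (q ^ 2) ^ k) ≠ 0 :=
    prod_ne_zero_iff.mpr fun k hk => hxq k (mem_range.mp hk)
  rw [prod_div_distrib, hclosed, mul_div_assoc, div_self hne, mul_one] at key
  rw [← key]
  refine sum_congr rfl fun i _ => ?_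
  simp only [← pow_succ']
  rw [hterm, prod_div_distrib, prod_div_distrib]
  ring

theorem stmt9
    {F : Type*} [Field F]
    (q a : F) (hq0 : q ≠ 0) (ha0 : a ≠ 0) (hq4 : q ^ 4 ≠ 1)
    (d : ℕ) (hd : 1 ≤ d)
    (hq2i : ∀ i : ℕ, 1 ≤ i → i ≤ d → q ^ (2 * i) ≠ 1)
    (ha2 : ∀ j : ℤ, 1 - (d : ℤ) ≤ j → j ≤ (d : ℤ) - 1 → a ^ 2 ≠ q ^ (2 * j))
    (θ t : ℕ → F)
    (hθ : ∀ i : ℕ, i ≤ d → θ i = a * q ^ ((d : ℤ) - 2 * (i : ℤ)) + a⁻¹ * q ^ (2 * (i : ℤ) - (d : ℤ)))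
    (ht : ∀ i : ℕ, i ≤ d → t i = (-1 : F) ^ i * a ^ i * q ^ (i * (d - i)))
    (r s : ℕ) (hrs : r ≤ s) (hsd : s ≤ d) :
    t r / t s =
      ∑ i ∈ Finset.range (s - r + 1),
        (-1 : F) ^ i * q ^ (i ^ 2) * (∏ k ∈ Finset.range i, (θ r - θ (s - k))) /
          ((∏ k ∈ Finset.range i, (1 - q ^ 2 * (q ^ 2) ^ k)) *
            (∏ k ∈ Finset.range i, (1 - a * q ^ ((d : ℤ) - 2 * (s : ℤ) + 1) * (q ^ 2) ^ k))) ∧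
    t s / t r =
      ∑ i ∈ Finset.range (s - r + 1),
        (-1 : F) ^ i * q ^ (-((i : ℤ) ^ 2)) * (∏ k ∈ Finset.range i, (θ r - θ (s - k))) /
          ((∏ k ∈ Finset.range i, (1 - q ^ (-2 : ℤ) * (q ^ (-2 : ℤ)) ^ k)) *
            (∏ k ∈ Finset.range i, (1 - a⁻¹ * q ^ (2 * (s : ℤ) - (d : ℤ) - 1) * (q ^ (-2 : ℤ)) ^ k))) := by
  obtain ⟨n, rfl⟩ : ∃ n, s = r + n := ⟨s - r, by omega⟩
  obtain ⟨e, rfl⟩ : ∃ e, d = r + n + e := ⟨d - (r + n), by omega⟩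
  rw [show r + n - r = n by omega]
  obtain ⟨x, hx⟩ : ∃ x : F, x = a * q ^ ((e : ℤ) - r - n) := ⟨_, rfl⟩
  have hx0 : x ≠ 0 := hx ▸ mul_ne_zero ha0 (zpow_ne_zero _ hq0)
  have hθx : ∀ k ≤ n, θ (r + n - k) = x * (q ^ 2) ^ k + (x * (q ^ 2) ^ k)⁻¹ := by
    intro k hk
    have hpow : x * (q ^ 2) ^ k = a * q ^ (((r + n + e : ℕ) : ℤ) - 2 * ((r + n - k : ℕ) : ℤ)) := by
      rw [hx, ← zpow_natCast, ← zpow_natCast, ← zpow_mul, mul_assoc, ← zpow_add₀ hq0]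
      congr 2
      push_cast [show k ≤ r + n by omega]
      ring
    rw [hθ _ (by omega), hpow, mul_inv, ← zpow_neg, neg_sub]
  have hθr : θ r = x * (q ^ 2) ^ n + (x * (q ^ 2) ^ n)⁻¹ := by
    simpa using hθx n le_rfl
  have hxq : ∀ k < n, x * q * (q ^ 2) ^ k ≠ 1 := by
    intro k hk h
    refine ha2 (r + n - e - 1 - 2 * k) (by push_cast; omega) (by push_cast; omega) ?_
    have hexp : x * q * (q ^ 2) ^ k = a * q ^ (-((r : ℤ) + n - e - 1 - 2 * k)) := by
      rw [hx, ← pow_mul, mul_assoc, mul_assoc, ← pow_succ', ← zpow_natCast, ← zpow_add₀ hq0]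
      congr 2
      push_cast
      ring
    rw [hexp, zpow_neg, mul_inv_eq_one₀ (zpow_ne_zero _ hq0)] at h
    rw [h, ← zpow_natCast, ← zpow_mul]
    congr 1
    push_cast
    ring
  have htr : t r / t (r + n) = (-1) ^ n * (x ^ n)⁻¹ * (q ^ (n ^ 2))⁻¹ := by
    have hxn : x ^ n * q ^ (n ^ 2) * q ^ (r * (n + e)) = a ^ n * q ^ ((r + n) * e) := by
      rw [hx, mul_pow, ← zpow_natCast (q ^ _), ← zpow_mul]
      simp only [← zpow_natCast q, mul_assoc, ← zpow_add₀ hq0]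
      congr 2
      push_cast
      ring
    rw [ht _ (by omega), ht _ hsd, show r + n + e - r = n + e by omega,
      show r + n + e - (r + n) = e by omega, div_eq_iff (by simp [hq0, ha0]), pow_add, pow_add a]
    have hsign : ((-1 : F) ^ n) * (-1) ^ n = 1 := by rw [← mul_pow]; simp
    field_simp
    linear_combination hxn - a ^ n * q ^ ((r + n) * e) * hsign
  have hqn : ∀ i, 1 ≤ i → i ≤ n → q ^ (2 * i) ≠ 1 := fun i h1 h2 => hq2i i h1 (by omega)
  have hprod : ∀ i ∈ Finset.range (n + 1),
      ∏ k ∈ Finset.range i, (x * (q ^ 2) ^ n + (x * (q ^ 2) ^ n)⁻¹ - θ (r + n - k)) =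
        ∏ k ∈ Finset.range i, (x * (q ^ 2) ^ n + (x * (q ^ 2) ^ n)⁻¹ -
          (x * (q ^ 2) ^ k + (x * (q ^ 2) ^ k)⁻¹)) := by
    intro i hi
    refine Finset.prod_congr rfl fun k hk => ?_
    rw [hθx k (by rw [Finset.mem_range] at hi hk; omega)]
  constructor
  · rw [htr, ← sum_prod_add_inv_sub_add_inv q x hq0 hx0 n hqn
      fun k hk => sub_ne_zero.mpr (hxq k hk).symm]
    refine Finset.sum_congr rfl fun i hi => ?_
    have hxe : a * q ^ (((r + n + e : ℕ) : ℤ) - 2 * ((r + n : ℕ) : ℤ) + 1) = x * q := by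
      rw [hx, mul_assoc, ← zpow_add_one₀ hq0]
      congr 2
      push_cast
      ring
    rw [hxe, hθr, hprod i hi]
  · have hinv : t (r + n) / t r = (-1) ^ n * (x⁻¹ ^ n)⁻¹ * (q⁻¹ ^ (n ^ 2))⁻¹ := by
      rw [← inv_div, htr]
      have hsign : ((-1 : F) ^ n)⁻¹ = (-1) ^ n := by simp [← inv_pow]
      simp only [mul_inv, inv_pow, inv_inv, hsign]
    rw [hinv, ← sum_prod_add_inv_sub_add_inv q⁻¹ x⁻¹ (inv_ne_zero hq0) (inv_ne_zero hx0) n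
      (fun i h1 h2 => by rw [inv_pow]; exact fun h => hqn i h1 h2 (inv_eq_one.mp h))
      fun k hk => sub_ne_zero.mpr fun h => hxq k hk (by
        simpa only [inv_pow, ← mul_inv, inv_eq_one] using h.symm)]
    refine Finset.sum_congr rfl fun i hi => ?_
    have hxe : a⁻¹ * q ^ (2 * ((r + n : ℕ) : ℤ) - ((r + n + e : ℕ) : ℤ) - 1) = x⁻¹ * q⁻¹ := by
      rw [hx, mul_inv, ← zpow_neg, mul_assoc, ← zpow_sub_one₀ hq0]
      congr 2
      push_cast
      ring
    have hq2 : q ^ (-2 : ℤ) = q⁻¹ ^ 2 := by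
      rw [zpow_neg, inv_pow]
      norm_cast
    have hqi : q ^ (-((i : ℤ) ^ 2)) = q⁻¹ ^ (i ^ 2) := by
      rw [zpow_neg, inv_pow]
      norm_cast
    have hsymm : ∀ k, x⁻¹ * (q⁻¹ ^ 2) ^ k + (x⁻¹ * (q⁻¹ ^ 2) ^ k)⁻¹ =
        x * (q ^ 2) ^ k + (x * (q ^ 2) ^ k)⁻¹ := by
      intro k
      simp only [inv_pow, ← mul_inv, inv_inv]
      exact add_comm _ _
    simp only [hsymm]
    rw [hxe, hq2, hqi, hθr, hprod i hi]
end

section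
/- Let A, K, W ∈ 𝒜 with K and W invertible, and assume W^{-2}KW^{2} = a^{-1}A − a^{-2}K^{-1} and (qAK^{-1} − q^{-1}K^{-1}A)/(q − q^{-1}) = a^{-1}K^{-2} + aI. Then (q W^{-2}KW^{2} K^{-1} − q^{-1} K^{-1} W^{-2}KW^{2})/(q − q^{-1}) = I and (q K W^{2}K^{-1}W^{-2} − q^{-1} W^{2}K^{-1}W^{-2} K)/(q − q^{-1}) = I. -/
theorem stmt10
    {F : Type*} [Field F] {A : Type*} [Ring A] [Algebra F A]
    (q a : F) (hq0 : q ≠ 0) (ha0 : a ≠ 0) (hq4 : q ^ 4 ≠ 1)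
    (X K W Kinv Winv : A)
    (hK : K * Kinv = 1) (hK' : Kinv * K = 1)
    (hW : W * Winv = 1) (hW' : Winv * W = 1)
    (h1 : Winv * Winv * K * (W * W) = a⁻¹ • X - (a ^ 2)⁻¹ • Kinv)
    (h2 : (q - q⁻¹)⁻¹ • (q • (X * Kinv) - q⁻¹ • (Kinv * X)) = a⁻¹ • (Kinv * Kinv) + a • 1) :
    (q - q⁻¹)⁻¹ • (q • (Winv * Winv * K * (W * W) * Kinv)
        - q⁻¹ • (Kinv * (Winv * Winv * K * (W * W)))) = 1 ∧
    (q - q⁻¹)⁻¹ • (q • (K * (W * W * Kinv * (Winv * Winv)))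
        - q⁻¹ • (W * W * Kinv * (Winv * Winv) * K)) = 1 := by
  have hq : q - q⁻¹ ≠ 0 := by
    intro h
    have hqq : q * q = 1 := by
      nth_rewrite 2 [sub_eq_zero.mp h]
      exact mul_inv_cancel₀ hq0
    exact hq4 (by linear_combination (q * q + 1) * hqq)
  have first : (q - q⁻¹)⁻¹ • (q • (Winv * Winv * K * (W * W) * Kinv)
      - q⁻¹ • (Kinv * (Winv * Winv * K * (W * W)))) = 1 := by
    have expand : q • ((a⁻¹ • X - (a ^ 2)⁻¹ • Kinv) * Kinv)
        - q⁻¹ • (Kinv * (a⁻¹ • X - (a ^ 2)⁻¹ • Kinv))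
        = a⁻¹ • (q • (X * Kinv) - q⁻¹ • (Kinv * X))
          - ((q - q⁻¹) * (a ^ 2)⁻¹) • (Kinv * Kinv) := by
      simp only [sub_mul, mul_sub, smul_mul_assoc, mul_smul_comm]
      module
    rw [h1, expand, smul_sub, smul_comm, h2, smul_smul, inv_mul_cancel_left₀ hq, smul_add,
      smul_smul, smul_smul, inv_mul_cancel₀ ha0, one_smul, ← mul_inv, ← sq, add_sub_cancel_left]
  refine ⟨first, ?_⟩
  have cancel (x : A) : W * (Winv * x) = x := by rw [← mul_assoc, hW, one_mul]
  have conj := congrArg (fun x => W * (W * (x * (Winv * Winv)))) first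
  simpa only [sub_mul, mul_sub, smul_sub, smul_mul_assoc, mul_smul_comm, mul_assoc, cancel,
    one_mul, hW, mul_one] using conj
end

section
/- Let A, K, M, W ∈ 𝒜 with K, M, W invertible. Assume that A commutes with W, that A = a W^{-1}KW + a^{-1} WK^{-1}W^{-1}, and that (aA − a^2K, M^{-1}, K) is an equitable triple. Set Q = W^{-1}MW. Then (WK^{-1}W^{-1}, Q^{-1}, W^{-1}KW) is an equitable triple. -/
/-- A triple `X, Y, Z` of invertible elements of an `F`-algebra is an *equitable triple*
whenever `(qXY − q⁻¹YX)/(q − q⁻¹) = 1`, `(qYZ − q⁻¹ZY)/(q − q⁻¹) = 1` and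
`(qZX − q⁻¹XZ)/(q − q⁻¹) = 1`. -/
def IsEquitableTriple {F : Type*} [Field F] {A : Type*} [Ring A] [Algebra F A]
    (q : F) (X Y Z : A) : Prop :=
  IsUnit X ∧ IsUnit Y ∧ IsUnit Z ∧
  (q - q⁻¹)⁻¹ • (q • (X * Y) - q⁻¹ • (Y * X)) = 1 ∧
  (q - q⁻¹)⁻¹ • (q • (Y * Z) - q⁻¹ • (Z * Y)) = 1 ∧
  (q - q⁻¹)⁻¹ • (q • (Z * X) - q⁻¹ • (X * Z)) = 1

/-- The image of an equitable triple under an algebra homomorphism is equitable. -/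
theorem IsEquitableTriple.map {F : Type*} [Field F] {A B : Type*} [Ring A] [Algebra F A]
    [Ring B] [Algebra F B] {q : F} {X Y Z : A} (h : IsEquitableTriple q X Y Z) (f : A →ₐ[F] B) :
    IsEquitableTriple q (f X) (f Y) (f Z) := by
  obtain ⟨hX, hY, hZ, hXY, hYZ, hZX⟩ := h
  refine ⟨hX.map f, hY.map f, hZ.map f, ?_, ?_, ?_⟩
  · simpa only [map_smul, map_sub, map_mul, map_one] using congrArg f hXY
  · simpa only [map_smul, map_sub, map_mul, map_one] using congrArg f hYZ
  · simpa only [map_smul, map_sub, map_mul, map_one] using congrArg f hZX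

/-- Conjugation `x ↦ W⁻¹xW` as an algebra homomorphism. -/
def conjAlgHom (F : Type*) [Field F] {A : Type*} [Ring A] [Algebra F A] {W Winv : A}
    (hW : W * Winv = 1) (hW' : Winv * W = 1) : A →ₐ[F] A :=
  AlgHom.ofLinearMap (LinearMap.mulLeftRight F (Winv, W)) (by simpa using hW') fun x y => by
    simp only [LinearMap.mulLeftRight_apply]
    calc Winv * (x * y) * W = Winv * x * 1 * y * W := by simp only [mul_one, mul_assoc]
      _ = Winv * x * W * (Winv * y * W) := by rw [← hW]; simp only [mul_assoc]

theorem stmt12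
    {F : Type*} [Field F] {A : Type*} [Ring A] [Algebra F A]
    (q a : F) (hq0 : q ≠ 0) (ha0 : a ≠ 0) (hq4 : q ^ 4 ≠ 1)
    (X K M W Kinv Minv Winv : A)
    (hK : K * Kinv = 1) (hK' : Kinv * K = 1)
    (hM : M * Minv = 1) (hM' : Minv * M = 1)
    (hW : W * Winv = 1) (hW' : Winv * W = 1)
    (hXW : X * W = W * X)
    (hX : X = a • (Winv * K * W) + a⁻¹ • (W * Kinv * Winv))
    (htriple : IsEquitableTriple q (a • X - (a ^ 2) • K) Minv K) :
    IsEquitableTriple q (W * Kinv * Winv) (Winv * Minv * W) (Winv * K * W) := by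
  let f := conjAlgHom F hW hW'
  have hfX : f X = X := by
    change Winv * X * W = X
    rw [mul_assoc, hXW, ← mul_assoc, hW', one_mul]
  have key : f (a • X - a ^ 2 • K) = W * Kinv * Winv := by
    rw [map_sub, map_smul, map_smul, hfX]
    change a • X - a ^ 2 • (Winv * K * W) = _
    rw [hX, smul_add, smul_smul, smul_smul, mul_inv_cancel₀ ha0, one_smul, sq,
      add_sub_cancel_left]
  rw [← key]
  exact htriple.map f
end

section
/- Let A, K, M, N, ψ ∈ 𝒜 with K, M, N invertible. Assume q(aA − a^2K)M^{-1} − q^{-1}M^{-1}(aA − a^2K) = (q − q^{-1})I, KM^{-1} = I − a^{-1}qψ, and M^{-1}K = I − a^{-1}q^{-1}ψ; assume also qN^{-1}(a^{-1}A − a^{-2}K^{-1}) − q^{-1}(a^{-1}A − a^{-2}K^{-1})N^{-1} = (q − q^{-1})I, K^{-1}N^{-1} = I − aq^{-1}ψ, and N^{-1}K^{-1} = I − aqψ. Then ψ + (qAM^{-1} − q^{-1}M^{-1}A)/(q^2 − q^{-2}) = ((a + a^{-1})/(q + q^{-1})) I and ψ + (qN^{-1}A − q^{-1}AN^{-1})/(q^2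 − q^{-2}) = ((a + a^{-1})/(q + q^{-1})) I. -/
/-- If `q • (a • P - a² • U) - q⁻¹ • (a • Q - a² • V) = (q - q⁻¹) • e`, where `U` and `V` are the
given affine expressions in `ψ`, then `ψ` is determined by `q • P - q⁻¹ • Q`. -/
theorem add_smul_qcommutator_eq {F : Type*} [Field F] {W : Type*} [AddCommGroup W] [Module F W]
    {q a : F} (hq0 : q ≠ 0) (ha0 : a ≠ 0) (hq4 : q ^ 4 ≠ 1) {P Q U V ψ e : W}
    (h : q • (a • P - (a ^ 2) • U) - q⁻¹ • (a • Q - (a ^ 2) • V) = (q - q⁻¹) • e)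
    (hU : U = e - (a⁻¹ * q) • ψ) (hV : V = e - (a⁻¹ * q⁻¹) • ψ) :
    ψ + (q ^ 2 - (q ^ 2)⁻¹)⁻¹ • (q • P - q⁻¹ • Q) = ((a + a⁻¹) / (q + q⁻¹)) • e := by
  subst hU hV
  have hm : q ^ 2 - 1 ≠ 0 := fun h0 => hq4 (by linear_combination (q ^ 2 + 1) * h0)
  have hp : q ^ 2 + 1 ≠ 0 := fun h0 => hq4 (by linear_combination (q ^ 2 - 1) * h0)
  have hd : q ^ 2 - (q ^ 2)⁻¹ = (q ^ 2 - 1) * (q ^ 2 + 1) / q ^ 2 := by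
    field_simp
    ring
  have hs : q + q⁻¹ = (q ^ 2 + 1) / q := by
    field_simp
  have hY : q • P - q⁻¹ • Q
      = ((a + a⁻¹) * (q - q⁻¹)) • e - (q ^ 2 - (q ^ 2)⁻¹) • ψ := by
    have h' := congrArg (a⁻¹ • ·) h
    simp only [smul_sub, smul_smul] at h'
    rw [← sub_eq_zero] at h' ⊢
    rw [← h']
    match_scalars <;> field_simp <;> ring
  rw [hY, hd, hs]
  match_scalars <;> field_simp <;> ring

theorem stmt13
    {F : Type*} [Field F] {A : Type*} [Ring A] [Algebra F A]
    (q a : F) (hq0 : q ≠ 0) (ha0 : a ≠ 0) (hq4 : q ^ 4 ≠ 1)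
    (X K M N ψ Kinv Minv Ninv : A)
    (hK : K * Kinv = 1) (hK' : Kinv * K = 1)
    (hM : M * Minv = 1) (hM' : Minv * M = 1)
    (hN : N * Ninv = 1) (hN' : Ninv * N = 1)
    (h1 : q • ((a • X - (a ^ 2) • K) * Minv) - q⁻¹ • (Minv * (a • X - (a ^ 2) • K))
        = (q - q⁻¹) • 1)
    (h2 : K * Minv = 1 - (a⁻¹ * q) • ψ)
    (h3 : Minv * K = 1 - (a⁻¹ * q⁻¹) • ψ)
    (h4 : q • (Ninv * (a⁻¹ • X - (a ^ 2)⁻¹ • Kinv))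
        - q⁻¹ • ((a⁻¹ • X - (a ^ 2)⁻¹ • Kinv) * Ninv) = (q - q⁻¹) • 1)
    (h5 : Kinv * Ninv = 1 - (a * q⁻¹) • ψ)
    (h6 : Ninv * Kinv = 1 - (a * q) • ψ) :
    ψ + (q ^ 2 - (q ^ 2)⁻¹)⁻¹ • (q • (X * Minv) - q⁻¹ • (Minv * X))
      = ((a + a⁻¹) / (q + q⁻¹)) • 1 ∧
    ψ + (q ^ 2 - (q ^ 2)⁻¹)⁻¹ • (q • (Ninv * X) - q⁻¹ • (X * Ninv))
      = ((a + a⁻¹) / (q + q⁻¹)) • 1 := by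
  refine ⟨add_smul_qcommutator_eq hq0 ha0 hq4 ?_ h2 h3, ?_⟩
  · simpa only [sub_mul, mul_sub, smul_mul_assoc, mul_smul_comm] using h1
  · have hc : a + a⁻¹ = a⁻¹ + a⁻¹⁻¹ := by rw [inv_inv, add_comm]
    rw [hc]
    refine add_smul_qcommutator_eq (U := Ninv * Kinv) (V := Kinv * Ninv)
      hq0 (inv_ne_zero ha0) hq4 ?_ (by rwa [inv_inv]) (by rwa [inv_inv])
    simpa only [sub_mul, mul_sub, smul_mul_assoc, mul_smul_comm, inv_pow] using h4
end
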